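/- arXiv:2602.21851 — 3 statements merged into one kernel-verified Lean document; each statement's English description precedes it below -/
import Mathlib

section
/- Let d ≥ 3 and 1 ≤ p < d²/2. There exist constants θ = θ(p,d) > 0 and C = C(p,d) < ∞ such that for all n ≥ 1 and all λ > 0, if X_1,…,X_n, Y_1,…,Y_n are i.i.d. random variables uniformly distributed on [0,1]^d, then ℙ( |C^p_bM(X,Y) − 𝔼[C^p_bM(X,Y)]| ≥ λ n^{1−p/d} ) ≤ C n^{−θ} λ^{−2}. -/
open MeasureTheory Metric
open scoped Classical

/-- The unit cube `[0,1]^d` in `ℝ^d` (with the Euclidean norm). -/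
def unitCube (d : ℕ) : Set (EuclideanSpace ℝ (Fin d)) :=
  {x | ∀ k, x k ∈ Set.Icc (0 : ℝ) 1}

/-- The uniform probability measure on the unit cube `[0,1]^d`
(Lebesgue measure restricted to the cube, which has total mass one). -/
noncomputable def cubeUniform (d : ℕ) : Measure (EuclideanSpace ℝ (Fin d)) :=
  volume.restrict (unitCube d)

/-- The `p`-cost of the bipartite matching given by a permutation `σ`:
`∑_{i=1}^n |x_i − y_{σ(i)}|^p`. -/
noncomputable def bMatchLen {d n : ℕ} (p : ℝ)
    (x y : Fin n → EuclideanSpace ℝ (Fin d)) (σ : Equiv.Perm (Fin n)) : ℝ :=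
  ∑ i, ‖x i - y (σ i)‖ ^ p

/-- The optimal bipartite matching `p`-cost
`C^p_bM(x,y) = min_σ ∑_{i=1}^n |x_i − y_{σ(i)}|^p`. -/
noncomputable def bMatchCost {d n : ℕ} (p : ℝ)
    (x y : Fin n → EuclideanSpace ℝ (Fin d)) : ℝ :=
  ⨅ σ : Equiv.Perm (Fin n), bMatchLen p x y σ

/-- The joint law of two independent samples of `n` i.i.d. points,
each uniformly distributed on `[0,1]^d`. -/
noncomputable def pairMeasure (d n : ℕ) :
    Measure ((Fin n → EuclideanSpace ℝ (Fin d)) × (Fin n → EuclideanSpace ℝ (Fin d))) :=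
  (Measure.pi fun _ : Fin n => cubeUniform d).prod
    (Measure.pi fun _ : Fin n => cubeUniform d)

section Tensorization

open ProbabilityTheory

theorem memLp_two_of_abs_le {α : Type*} [MeasurableSpace α] {μ : Measure α} [IsFiniteMeasure μ]
    {F : α → ℝ} (hF : Measurable F) {M : ℝ} (hM : ∀ z, |F z| ≤ M) : MemLp F 2 μ :=
  MemLp.of_bound hF.aestronglyMeasurable M (Filter.Eventually.of_forall hM)

theorem integrable_of_abs_le {α : Type*} [MeasurableSpace α] {μ : Measure α} [IsFiniteMeasure μ]
    {F : α → ℝ} (hF : Measurable F) {M : ℝ} (hM : ∀ z, |F z| ≤ M) : Integrable F μ :=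
  Integrable.of_bound hF.aestronglyMeasurable M (Filter.Eventually.of_forall hM)

theorem abs_integral_le_of_abs_le {α : Type*} [MeasurableSpace α] {μ : Measure α}
    [IsProbabilityMeasure μ] {F : α → ℝ} {M : ℝ} (hM : ∀ z, |F z| ≤ M) :
    |∫ z, F z ∂μ| ≤ M := by
  simpa using norm_integral_le_of_norm_le_const (μ := μ) (f := F) (Filter.Eventually.of_forall hM)

/-- The lower Lebesgue integral of the slice variances as a difference of Bochner integrals. -/
theorem lintegral_evariance_slice {α β : Type*} [MeasurableSpace α] [MeasurableSpace β]
    {μ : Measure α} {ν : Measure β} [IsProbabilityMeasure μ] [IsProbabilityMeasure ν]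
    {F : α × β → ℝ} (hF : Measurable F) {M : ℝ} (hM : ∀ z, |F z| ≤ M) :
    ∫⁻ x, evariance (fun y => F (x, y)) ν ∂μ =
      ENNReal.ofReal (∫ z, F z ^ 2 ∂(μ.prod ν) - ∫ x, (∫ y, F (x, y) ∂ν) ^ 2 ∂μ) := by
  have hM2 : ∀ z, |F z ^ 2| ≤ M ^ 2 := fun z => by
    rw [abs_pow]; exact pow_le_pow_left₀ (abs_nonneg _) (hM z) 2
  have hmg : Measurable fun x => ∫ y, F (x, y) ∂ν :=
    (hF.stronglyMeasurable.integral_prod_right' (ν := ν)).measurable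
  have hms : Measurable fun x => ∫ y, F (x, y) ^ 2 ∂ν :=
    ((hF.pow_const 2).stronglyMeasurable.integral_prod_right' (ν := ν)).measurable
  have hbs : ∀ x, |∫ y, F (x, y) ^ 2 ∂ν| ≤ M ^ 2 := fun x =>
    abs_integral_le_of_abs_le fun y => hM2 (x, y)
  have hbg : ∀ x, |(∫ y, F (x, y) ∂ν) ^ 2| ≤ M ^ 2 := fun x => by
    rw [abs_pow]
    exact pow_le_pow_left₀ (abs_nonneg _) (abs_integral_le_of_abs_le fun y => hM (x, y)) 2
  have hL : ∀ x, MemLp (fun y => F (x, y)) 2 ν := fun x =>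
    memLp_two_of_abs_le (hF.comp measurable_prodMk_left) fun y => hM (x, y)
  have hv : ∀ x, variance (fun y => F (x, y)) ν =
      ∫ y, F (x, y) ^ 2 ∂ν - (∫ y, F (x, y) ∂ν) ^ 2 := fun x => by
    rw [variance_eq_sub (hL x)]; rfl
  have i1 : Integrable (fun x => ∫ y, F (x, y) ^ 2 ∂ν) μ := integrable_of_abs_le hms hbs
  have i2 : Integrable (fun x => (∫ y, F (x, y) ∂ν) ^ 2) μ :=
    integrable_of_abs_le (hmg.pow_const 2) hbg
  simp_rw [← ofReal_variance (hL _)]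
  rw [← ofReal_integral_eq_lintegral_ofReal]
  · congr 1
    simp_rw [hv]
    rw [integral_sub i1 i2, integral_prod _ (integrable_of_abs_le (hF.pow_const 2) hM2)]
  · simp_rw [hv]; exact i1.sub i2
  · exact Filter.Eventually.of_forall fun x => variance_nonneg _ _

/-- The Efron–Stein inequality for two independent variables. -/
theorem evariance_prod_le {α β : Type*} [MeasurableSpace α] [MeasurableSpace β]
    {μ : Measure α} {ν : Measure β} [IsProbabilityMeasure μ] [IsProbabilityMeasure ν]
    {F : α × β → ℝ} (hF : Measurable F) {M : ℝ} (hM : ∀ z, |F z| ≤ M) :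
    evariance F (μ.prod ν) ≤
      ∫⁻ x, evariance (fun y => F (x, y)) ν ∂μ + ∫⁻ y, evariance (fun x => F (x, y)) μ ∂ν := by
  have hM2 : ∀ z, |F z ^ 2| ≤ M ^ 2 := fun z => by
    rw [abs_pow]; exact pow_le_pow_left₀ (abs_nonneg _) (hM z) 2
  have e2 := lintegral_evariance_slice (μ := ν) (ν := μ) (hF.comp measurable_swap)
    fun z => hM z.swap
  simp only [Function.comp_def, Prod.swap_prod_mk] at e2
  rw [← ofReal_variance (memLp_two_of_abs_le hF hM), lintegral_evariance_slice hF hM, e2,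
    integral_prod_swap (fun z => F z ^ 2)]
  refine le_trans ?_ ENNReal.ofReal_add_le
  apply ENNReal.ofReal_le_ofReal
  rw [variance_eq_sub (memLp_two_of_abs_le hF hM)]
  set g : α → ℝ := fun x => ∫ y, F (x, y) ∂ν with hg
  set h : β → ℝ := fun y => ∫ x, F (x, y) ∂μ with hh
  have hgm : Measurable g := (hF.stronglyMeasurable.integral_prod_right' (ν := ν)).measurable
  have hhm : Measurable h := (hF.stronglyMeasurable.integral_prod_left' (μ := μ)).measurable
  have hgM : ∀ x, |g x| ≤ M := fun x => abs_integral_le_of_abs_le fun y => hM (x, y)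
  have hhM : ∀ y, |h y| ≤ M := fun y => abs_integral_le_of_abs_le fun x => hM (x, y)
  have hM0 : 0 ≤ M := by
    obtain ⟨x⟩ : Nonempty α := nonempty_of_isProbabilityMeasure μ
    exact (abs_nonneg _).trans (hgM x)
  have bmul : ∀ {a b : ℝ}, |a| ≤ M → |b| ≤ M → |a * b| ≤ M * M := fun ha hb => by
    rw [abs_mul]; exact mul_le_mul ha hb (abs_nonneg _) hM0
  have hFi : Integrable F (μ.prod ν) := integrable_of_abs_le hF hM
  set c : ℝ := ∫ z, F z ∂(μ.prod ν) with hc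
  have cg : ∫ x, g x ∂μ = c := (integral_prod F hFi).symm
  have ch : ∫ y, h y ∂ν = c := (integral_prod_symm F hFi).symm
  have key : 0 ≤ ∫ z, (F z - g z.1 - h z.2 + c) ^ 2 ∂(μ.prod ν) :=
    integral_nonneg fun z => sq_nonneg _
  have iF2 : Integrable (fun z => F z ^ 2) (μ.prod ν) := integrable_of_abs_le (hF.pow_const 2) hM2
  have mg1 : Measurable fun z : α × β => g z.1 := hgm.comp measurable_fst
  have mh2 : Measurable fun z : α × β => h z.2 := hhm.comp measurable_snd
  have ig2 : Integrable (fun z : α × β => g z.1 * g z.1) (μ.prod ν) :=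
    integrable_of_abs_le (mg1.mul mg1) fun z => bmul (hgM z.1) (hgM z.1)
  have ih2 : Integrable (fun z : α × β => h z.2 * h z.2) (μ.prod ν) :=
    integrable_of_abs_le (mh2.mul mh2) fun z => bmul (hhM z.2) (hhM z.2)
  have igh : Integrable (fun z : α × β => g z.1 * h z.2) (μ.prod ν) :=
    integrable_of_abs_le (mg1.mul mh2) fun z => bmul (hgM z.1) (hhM z.2)
  have iFg : Integrable (fun z : α × β => g z.1 * F z) (μ.prod ν) :=
    integrable_of_abs_le (mg1.mul hF) fun z => bmul (hgM z.1) (hM z)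
  have iFh : Integrable (fun z : α × β => h z.2 * F z) (μ.prod ν) :=
    integrable_of_abs_le (mh2.mul hF) fun z => bmul (hhM z.2) (hM z)
  have vgg : ∫ z, g z.1 * g z.1 ∂(μ.prod ν) = ∫ x, g x ^ 2 ∂μ := by
    rw [integral_prod _ ig2]; simp [sq]
  have vhh : ∫ z, h z.2 * h z.2 ∂(μ.prod ν) = ∫ y, h y ^ 2 ∂ν := by
    rw [integral_prod _ ih2]; simp [sq]
  have vgh : ∫ z, g z.1 * h z.2 ∂(μ.prod ν) = c * c := by
    rw [integral_prod_mul, cg, ch]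
  have vFg : ∫ z, g z.1 * F z ∂(μ.prod ν) = ∫ x, g x ^ 2 ∂μ := by
    rw [integral_prod _ iFg]; simp [integral_const_mul, sq, hg]
  have vFh : ∫ z, h z.2 * F z ∂(μ.prod ν) = ∫ y, h y ^ 2 ∂ν := by
    rw [integral_prod_symm _ iFh]; simp [integral_const_mul, sq, hh]
  have ig : Integrable (fun z : α × β => g z.1) (μ.prod ν) :=
    integrable_of_abs_le mg1 fun z => hgM z.1
  have ih : Integrable (fun z : α × β => h z.2) (μ.prod ν) :=
    integrable_of_abs_le mh2 fun z => hhM z.2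
  have vg : ∫ z, g z.1 ∂(μ.prod ν) = c := by rw [integral_prod _ ig]; simpa using cg
  have vh : ∫ z, h z.2 ∂(μ.prod ν) = c := by rw [integral_prod _ ih]; simpa using ch
  have ig' := ig.const_mul (2 * c)
  have ih' := ih.const_mul (2 * c)
  have ic : Integrable (fun _ : α × β => c ^ 2) (μ.prod ν) := integrable_const _
  clear_value g h c
  have expand : ∀ z : α × β, (F z - g z.1 - h z.2 + c) ^ 2 =
      F z ^ 2 + g z.1 * g z.1 + h z.2 * h z.2 + 2 * (g z.1 * h z.2)
        + 2 * c * F z + c ^ 2 - 2 * (g z.1 * F z) - 2 * (h z.2 * F z)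
        - 2 * c * g z.1 - 2 * c * h z.2 := fun z => by ring
  simp_rw [expand] at key
  rw [integral_sub (by fun_prop) (by fun_prop), integral_sub (by fun_prop) (by fun_prop),
    integral_sub (by fun_prop) (by fun_prop), integral_sub (by fun_prop) (by fun_prop),
    integral_add (by fun_prop) (by fun_prop), integral_add (by fun_prop) (by fun_prop),
    integral_add (by fun_prop) (by fun_prop), integral_add (by fun_prop) (by fun_prop),
    integral_add (by fun_prop) (by fun_prop), integral_const_mul, integral_const_mul,
    integral_const_mul, integral_const_mul, integral_const_mul, integral_const_mul,
    vgg, vhh, vgh, vFg, vFh, vg, vh, ← hc] at key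
  simp only [Pi.pow_apply]
  simp only [integral_const, probReal_univ, one_smul] at key
  simp only [hg, hh] at key
  linarith

/-- The Efron–Stein inequality for finitely many i.i.d. variables: if each slice variance is
dominated by the slice integral of `G j`, the variance is dominated by the sum of the
integrals of the `G j`. -/
theorem evariance_pi_le {α : Type*} [MeasurableSpace α] (μ : Measure α) [IsProbabilityMeasure μ]
    (N : ℕ) (F : (Fin N → α) → ℝ) (hF : Measurable F) (M : ℝ) (hM : ∀ z, |F z| ≤ M)
    (G : Fin N → (Fin N → α) → ENNReal) (hG : ∀ j, Measurable (G j))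
    (h : ∀ z j, evariance (fun t => F (Function.update z j t)) μ ≤
      ∫⁻ t, G j (Function.update z j t) ∂μ) :
    evariance F (Measure.pi fun _ => μ) ≤ ∑ j, ∫⁻ z, G j z ∂(Measure.pi fun _ => μ) := by
  induction N with
  | zero =>
    have hc : ∀ z, F z = F default := fun z => by rw [Subsingleton.elim z default]
    have : F = fun _ => F default := funext hc
    rw [this]; simp [evariance]
  | succ N ih =>
    obtain ⟨a0⟩ : Nonempty α := nonempty_of_isProbabilityMeasure μ
    set e := (MeasurableEquiv.piFinSuccAbove (fun _ : Fin (N + 1) => α) 0).symm with he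
    have hmp : MeasurePreserving e (μ.prod (Measure.pi fun _ : Fin N => μ))
        (Measure.pi fun _ : Fin (N + 1) => μ) :=
      (measurePreserving_piFinSuccAbove (fun _ : Fin (N + 1) => μ) 0).symm _
    have hea : ∀ a w, e (a, w) = Fin.cons a w := fun a w => by
      simp [he, MeasurableEquiv.piFinSuccAbove, Fin.insertNthEquiv]
    have hev : evariance F (Measure.pi fun _ => μ) =
        evariance (fun z => F (e z)) (μ.prod (Measure.pi fun _ => μ)) := by
      unfold evariance
      rw [← hmp.lintegral_comp_emb e.measurableEmbedding,
        ← hmp.integral_comp e.measurableEmbedding]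
    have hGi : ∀ j, ∫⁻ z, G j z ∂(Measure.pi fun _ => μ) =
        ∫⁻ z, G j (e z) ∂(μ.prod (Measure.pi fun _ => μ)) := fun j =>
      (hmp.lintegral_comp_emb e.measurableEmbedding _).symm
    simp_rw [hev, hGi]
    refine (evariance_prod_le (hF.comp e.measurable) fun z => hM _).trans ?_
    rw [Fin.sum_univ_succ, add_comm]
    refine add_le_add ?_ ?_
    · rw [lintegral_prod_symm' (fun z => G 0 (e z)) ((hG 0).comp e.measurable)]
      refine lintegral_mono fun w => ?_
      have := h (Fin.cons a0 w) 0
      simpa only [Function.comp_apply, hea, Fin.update_cons_zero] using this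
    · have : ∀ a, evariance (fun w => F (e (a, w))) (Measure.pi fun _ => μ) ≤
          ∑ j : Fin N, ∫⁻ w, G j.succ (e (a, w)) ∂(Measure.pi fun _ => μ) := fun a => by
        refine ih (fun w => F (e (a, w))) (hF.comp (e.measurable.comp measurable_prodMk_left))
          (fun w => hM _) (fun j w => G j.succ (e (a, w)))
          (fun j => (hG _).comp (e.measurable.comp measurable_prodMk_left)) fun w j => ?_
        have := h (Fin.cons a w) j.succ
        simpa only [hea, Fin.cons_update] using this
      refine (lintegral_mono this).trans ?_
      rw [lintegral_finsetSum]
      · refine Finset.sum_le_sum fun j _ => ?_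
        rw [lintegral_prod (fun z => G j.succ (e z)) ((hG _).comp e.measurable).aemeasurable]
      · intro j _
        exact ((hG j.succ).comp e.measurable).lintegral_prod_right'

end Tensorization

section Poincare

open ProbabilityTheory

theorem evariance_le_lintegral_sub_sq {α : Type*} [MeasurableSpace α] {μ : Measure α}
    [IsProbabilityMeasure μ] {f : α → ℝ} (hf : Integrable f μ) (c : ℝ) :
    evariance f μ ≤ ∫⁻ x, ‖f x - c‖ₑ ^ 2 ∂μ := by
  have h : evariance f μ = evariance (fun x => f x - c) μ := by
    unfold evariance
    rw [integral_sub hf (integrable_const c)]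
    simp
  have hm : AEStronglyMeasurable (fun x => f x - c) μ :=
    (hf.sub (integrable_const c)).aestronglyMeasurable
  rw [h, evariance_def' hm]
  exact tsub_le_self

theorem sq_lintegral_enorm_le {α : Type*} [MeasurableSpace α] {μ : Measure α}
    [IsProbabilityMeasure μ] {f : α → ℝ} (hf : AEStronglyMeasurable f μ) :
    (∫⁻ x, ‖f x‖ₑ ∂μ) ^ 2 ≤ ∫⁻ x, ‖f x‖ₑ ^ 2 ∂μ := by
  have h := eLpNorm_le_eLpNorm_of_exponent_le (μ := μ) (p := 1) (q := 2) (by norm_num) hf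
  have h2 := eLpNorm_nnreal_pow_eq_lintegral (f := f) (μ := μ) (p := 2) (by norm_num)
  rw [eLpNorm_one_eq_lintegral_enorm] at h
  norm_num at h2
  rw [← h2]
  exact pow_le_pow_left₀ (zero_le) h 2

instance isProbabilityMeasure_unitInterval :
    IsProbabilityMeasure (volume.restrict (Set.Icc (0 : ℝ) 1)) :=
  ⟨by simp⟩

/-- The one-dimensional Poincaré inequality for Lipschitz functions. -/
theorem evariance_unitInterval_le {f : ℝ → ℝ} {K : NNReal}
    (hf : LipschitzOnWith K f (Set.Icc 0 1)) :
    evariance f (volume.restrict (Set.Icc 0 1)) ≤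
      ∫⁻ t in Set.Icc 0 1, ‖deriv f t‖ₑ ^ 2 := by
  have h_integrable : Integrable f (volume.restrict (Set.Icc 0 1)) :=
    hf.continuousOn.integrableOn_compact isCompact_Icc
  refine (evariance_le_lintegral_sub_sq h_integrable (f 0)).trans ?_
  have hm : AEStronglyMeasurable (deriv f) (volume.restrict (Set.Icc 0 1)) :=
    (measurable_deriv f).aestronglyMeasurable
  have key : ∀ t ∈ Set.Icc (0 : ℝ) 1,
      ‖f t - f 0‖ₑ ^ 2 ≤ ∫⁻ t in Set.Icc 0 1, ‖deriv f t‖ₑ ^ 2 := fun t ht => by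
    refine le_trans (pow_le_pow_left₀ zero_le ?_ 2) (sq_lintegral_enorm_le hm)
    have hac : AbsolutelyContinuousOnInterval f 0 t := by
      apply LipschitzOnWith.absolutelyContinuousOnInterval (K := K)
      apply hf.mono
      rw [Set.uIcc_of_le ht.1]
      exact Set.Icc_subset_Icc_right ht.2
    rw [← hac.integral_deriv_eq_sub, intervalIntegral.integral_of_le ht.1]
    refine (enorm_integral_le_lintegral_enorm _).trans ?_
    exact lintegral_mono_set fun s hs => ⟨hs.1.le, hs.2.trans ht.2⟩
  calc ∫⁻ t in Set.Icc 0 1, ‖f t - f 0‖ₑ ^ 2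
      ≤ ∫⁻ t in Set.Icc (0 : ℝ) 1, (∫⁻ t in Set.Icc 0 1, ‖deriv f t‖ₑ ^ 2) :=
        setLIntegral_mono' measurableSet_Icc key
    _ = _ := by simp

theorem measurableSet_unitCube (d : ℕ) : MeasurableSet (unitCube d) := by
  have : unitCube d = ⋂ k, (fun x : EuclideanSpace ℝ (Fin d) => x k) ⁻¹' Set.Icc 0 1 := by
    ext x; simp [unitCube]
  rw [this]
  exact MeasurableSet.iInter fun k => measurableSet_Icc.preimage (by fun_prop)

theorem measurePreserving_toLp_cubeUniform (d : ℕ) :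
    MeasurePreserving (MeasurableEquiv.toLp 2 (Fin d → ℝ))
      (Measure.pi fun _ : Fin d => volume.restrict (Set.Icc (0 : ℝ) 1)) (cubeUniform d) := by
  rw [← Measure.restrict_pi_pi]
  have h := (PiLp.volume_preserving_toLp (Fin d)).restrict_preimage (measurableSet_unitCube d)
  have hs : (Set.univ.pi fun _ : Fin d => Set.Icc (0 : ℝ) 1) =
      (WithLp.toLp 2) ⁻¹' (unitCube d) := by
    ext x; simp [unitCube, -Set.pi_univ_Icc]
  rw [hs]
  exact h

instance isProbabilityMeasure_cubeUniform (d : ℕ) : IsProbabilityMeasure (cubeUniform d) := by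
  rw [← (measurePreserving_toLp_cubeUniform d).map_eq]
  exact Measure.isProbabilityMeasure_map (MeasurableEquiv.measurable _).aemeasurable

/-- The Poincaré inequality on the cube, for a function that is Lipschitz on the cube. -/
theorem evariance_cubeUniform_le {d : ℕ} {f : EuclideanSpace ℝ (Fin d) → ℝ}
    (hf : Continuous f) {K : NNReal} (hL : LipschitzOnWith K f (unitCube d)) :
    evariance f (cubeUniform d) ≤
      ∑ j, ∫⁻ v, ‖lineDeriv ℝ f v (EuclideanSpace.single j 1)‖ₑ ^ 2 ∂(cubeUniform d) := by
  set ν := volume.restrict (Set.Icc (0 : ℝ) 1) with hν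
  set e := MeasurableEquiv.toLp 2 (Fin d → ℝ) with he
  have hmp := measurePreserving_toLp_cubeUniform d
  -- the restriction of `f` to the cube, extended by zero
  set F : (Fin d → ℝ) → ℝ := fun w => (unitCube d).indicator f (e w) with hF
  have hcube : ∀ w : Fin d → ℝ, e w ∈ unitCube d ↔ ∀ k, w k ∈ Set.Icc (0 : ℝ) 1 := fun w =>
    Iff.rfl
  have hae : ∀ᵐ v ∂(cubeUniform d), v ∈ unitCube d := ae_restrict_mem (measurableSet_unitCube d)
  have hev : evariance f (cubeUniform d) = evariance F (Measure.pi fun _ => ν) := by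
    have : f =ᵐ[cubeUniform d] (unitCube d).indicator f := by
      filter_upwards [hae] with v hv
      rw [Set.indicator_of_mem hv]
    rw [evariance_congr this]
    unfold evariance
    rw [← hmp.lintegral_comp_emb e.measurableEmbedding,
      ← hmp.integral_comp e.measurableEmbedding]
  have h0 : (0 : EuclideanSpace ℝ (Fin d)) ∈ unitCube d := fun k => by simp
  have hcompact : ∃ M, ∀ v ∈ unitCube d, |f v| ≤ M := by
    have hK : IsCompact (unitCube d) := by
      have : unitCube d = (EuclideanSpace.equiv (Fin d) ℝ).symm ''
          (Set.univ.pi fun _ : Fin d => Set.Icc (0 : ℝ) 1) := by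
        ext x
        constructor
        · intro hx
          exact ⟨fun k => x k, fun k _ => hx k, by ext k; rfl⟩
        · rintro ⟨w, hw, rfl⟩ k
          exact hw k trivial
      rw [this]
      exact (isCompact_univ_pi fun _ => isCompact_Icc).image (ContinuousLinearEquiv.continuous _)
    obtain ⟨M, hM⟩ := hK.exists_bound_of_continuousOn hf.continuousOn
    exact ⟨M, hM⟩
  obtain ⟨M, hM⟩ := hcompact
  have hM0 : 0 ≤ M := (abs_nonneg _).trans (hM 0 h0)
  rw [hev]
  refine (evariance_pi_le ν d F
    ((hf.measurable.indicator (measurableSet_unitCube d)).comp e.measurable) M ?_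
    (fun j w => ‖lineDeriv ℝ f (e w) (EuclideanSpace.single j 1)‖ₑ ^ 2) ?_ ?_).trans_eq ?_
  · intro w
    by_cases hw : e w ∈ unitCube d
    · simp only [hF, Set.indicator_of_mem hw]; exact hM _ hw
    · simp only [hF, Set.indicator_of_notMem hw]; simpa using hM0
  · intro j
    exact (((measurable_lineDeriv hf).comp e.measurable).enorm).pow_const 2
  · intro w j
    by_cases hw : ∀ k, k ≠ j → w k ∈ Set.Icc (0 : ℝ) 1
    · have hmem : ∀ t ∈ Set.Icc (0 : ℝ) 1, e (Function.update w j t) ∈ unitCube d := by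
        intro t ht
        rw [hcube]
        intro k
        by_cases hk : k = j
        · subst hk; simpa using ht
        · rw [Function.update_of_ne hk]; exact hw k hk
      have hc : (fun t => F (Function.update w j t)) =ᵐ[ν]
          fun t => f (e (Function.update w j t)) := by
        filter_upwards [ae_restrict_mem measurableSet_Icc] with t ht
        simp only [hF, Set.indicator_of_mem (hmem t ht)]
      have hadd : ∀ s t : ℝ, e (Function.update w j s) + t • EuclideanSpace.single j (1 : ℝ) =
          e (Function.update w j (s + t)) := by
        intro s t
        ext k
        by_cases hk : k = j
        · subst hk; simp [he]
        · simp [he, hk]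
      rw [evariance_congr hc]
      refine (evariance_unitInterval_le (K := K) ?_).trans_eq ?_
      · refine LipschitzOnWith.of_dist_le_mul fun s hs t ht => ?_
        refine (hL.dist_le_mul _ (hmem s hs) _ (hmem t ht)).trans_eq ?_
        congr 1
        have hts := hadd t (s - t)
        rw [add_sub_cancel] at hts
        rw [← hts, dist_self_add_left, norm_smul]
        simp [Real.dist_eq]
      · refine lintegral_congr fun t => ?_
        congr 2
        unfold lineDeriv
        simp_rw [hadd]
        rw [deriv_comp_const_add (f := fun t => f (e (Function.update w j t)))]
        simp
    · have : (fun t => F (Function.update w j t)) = 0 := by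
        push Not at hw
        obtain ⟨k, hk, hwk⟩ := hw
        funext t
        have : e (Function.update w j t) ∉ unitCube d := by
          rw [hcube]
          intro h
          have := h k
          rw [Function.update_of_ne hk] at this
          exact hwk this
        simp only [hF, Set.indicator_of_notMem this, Pi.zero_apply]
      rw [this, evariance_zero]
      exact zero_le
  · refine Finset.sum_congr rfl fun j _ => ?_
    exact hmp.lintegral_comp_emb e.measurableEmbedding
      (fun v => ‖lineDeriv ℝ f v (EuclideanSpace.single j 1)‖ₑ ^ 2)

end Poincare

section MatchingCost

theorem rpow_sub_rpow_le {p a b : ℝ} (hp : 1 ≤ p) (ha : 0 ≤ a) (hb : 0 ≤ b) :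
    b ^ p - a ^ p ≤ p * (a + |b - a|) ^ (p - 1) * |b - a| := by
  have hR : 0 ≤ p * (a + |b - a|) ^ (p - 1) * |b - a| := by positivity
  rcases le_or_gt b a with h | h
  · have := Real.rpow_le_rpow hb h (by linarith : 0 ≤ p)
    linarith
  · have hb0 : 0 < b := ha.trans_lt h
    have e : a + |b - a| = b := by rw [abs_of_pos (sub_pos.2 h)]; ring
    rw [e, abs_of_pos (sub_pos.2 h)]
    have h1 := one_add_mul_self_le_rpow_one_add (s := a / b - 1) (by
      have : 0 ≤ a / b := by positivity
      linarith) hp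
    rw [add_sub_cancel, Real.div_rpow ha hb0.le] at h1
    have h2 := mul_le_mul_of_nonneg_right h1 (Real.rpow_nonneg hb0.le p)
    have hbp : 0 < b ^ p := Real.rpow_pos_of_pos hb0 p
    rw [div_mul_cancel₀ _ hbp.ne'] at h2
    have h3 : b ^ p = b ^ (p - 1) * b := by
      rw [← Real.rpow_add_one hb0.ne', sub_add_cancel]
    have h4 : (1 + p * (a / b - 1)) * b ^ p = b ^ p - p * b ^ (p - 1) * (b - a) := by
      rw [h3]; field_simp; ring
    linarith

/-- A one-sided growth bound at a point bounds the directional derivatives there. -/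
theorem abs_lineDeriv_le {E : Type*} [NormedAddCommGroup E] [NormedSpace ℝ E] {f : E → ℝ} {v u : E}
    {p ρ : ℝ} (hp : 1 ≤ p)
    (h : ∀ t : ℝ, f (v + t • u) - f v ≤ p * (ρ + |t|) ^ (p - 1) * |t|) (hρ : 0 ≤ ρ) :
    |lineDeriv ℝ f v u| ≤ p * ρ ^ (p - 1) := by
  by_cases hd : LineDifferentiableAt ℝ f v u
  swap
  · rw [lineDeriv_zero_of_not_lineDifferentiableAt hd, abs_zero]; positivity
  have hD := hd.hasLineDerivAt
  have hc : Filter.Tendsto (fun t : ℝ => p * (ρ + |t|) ^ (p - 1)) (nhds 0)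
      (nhds (p * ρ ^ (p - 1))) := by
    have : ContinuousAt (fun t : ℝ => p * (ρ + |t|) ^ (p - 1)) 0 := by
      refine continuousAt_const.mul (ContinuousAt.rpow_const (by fun_prop) (Or.inr (by linarith)))
    simpa using this.tendsto
  have hR := HasDerivAt.tendsto_slope_zero_right hD
  have hL := HasDerivAt.tendsto_slope_zero_left hD
  simp only [zero_add, zero_smul, add_zero, smul_eq_mul] at hR hL
  rw [abs_le]
  constructor
  · refine le_of_tendsto_of_tendsto (hc.mono_left nhdsWithin_le_nhds).neg hL ?_
    filter_upwards [self_mem_nhdsWithin] with t (ht : t < 0)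
    have := h t
    rw [abs_of_neg ht] at this ⊢
    rw [inv_mul_eq_div, le_div_iff_of_neg ht]
    linarith
  · refine le_of_tendsto_of_tendsto hR (hc.mono_left nhdsWithin_le_nhds) ?_
    filter_upwards [self_mem_nhdsWithin] with t (ht : 0 < t)
    have := h t
    rw [abs_of_pos ht] at this ⊢
    rw [inv_mul_eq_div, div_le_iff₀ ht]
    exact this

variable {d n : ℕ} {p : ℝ}

theorem bMatchCost_le (x y : Fin n → EuclideanSpace ℝ (Fin d)) (σ : Equiv.Perm (Fin n)) :
    bMatchCost p x y ≤ bMatchLen p x y σ :=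
  ciInf_le (Set.finite_range _).bddBelow σ

theorem exists_bMatchCost_eq (p : ℝ) (x y : Fin n → EuclideanSpace ℝ (Fin d)) :
    ∃ σ, bMatchLen p x y σ = bMatchCost p x y :=
  exists_eq_ciInf_of_finite

theorem bMatchLen_nonneg (x y : Fin n → EuclideanSpace ℝ (Fin d)) (σ : Equiv.Perm (Fin n)) :
    0 ≤ bMatchLen p x y σ :=
  Finset.sum_nonneg fun _ _ => by positivity

theorem bMatchLen_swap (x y : Fin n → EuclideanSpace ℝ (Fin d)) (σ : Equiv.Perm (Fin n)) :
    bMatchLen p y x σ⁻¹ = bMatchLen p x y σ := by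
  unfold bMatchLen
  rw [← Equiv.sum_comp σ]
  refine Finset.sum_congr rfl fun i _ => ?_
  simp [norm_sub_rev]

theorem bMatchCost_comm (x y : Fin n → EuclideanSpace ℝ (Fin d)) :
    bMatchCost p x y = bMatchCost p y x := by
  unfold bMatchCost
  rw [← (Equiv.inv (Equiv.Perm (Fin n))).iInf_comp]
  refine iInf_congr fun σ => ?_
  rw [Equiv.inv_apply, ← bMatchLen_swap, inv_inv]

theorem continuous_bMatchCost (d n : ℕ) (hp : 1 ≤ p) :
    Continuous fun z : (Fin n → EuclideanSpace ℝ (Fin d)) × (Fin n → EuclideanSpace ℝ (Fin d)) =>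
      bMatchCost p z.1 z.2 := by
  have : ∀ z : (Fin n → EuclideanSpace ℝ (Fin d)) × (Fin n → EuclideanSpace ℝ (Fin d)),
      bMatchCost p z.1 z.2 = Finset.univ.inf' Finset.univ_nonempty
        fun σ => bMatchLen p z.1 z.2 σ := fun z => (Finset.inf'_univ_eq_ciInf _).symm
  simp_rw [this]
  refine Continuous.finset_inf'_apply _ fun σ _ => ?_
  unfold bMatchLen
  refine continuous_finsetSum _ fun i _ => ?_
  exact Continuous.rpow_const (by fun_prop) fun _ => Or.inr (by linarith)

/-- Moving one point changes the optimal cost at most by the change of its own edge. -/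
theorem bMatchCost_update_sub_le (hp : 1 ≤ p) (x y : Fin n → EuclideanSpace ℝ (Fin d))
    {σ : Equiv.Perm (Fin n)} (hσ : bMatchLen p x y σ = bMatchCost p x y) (i : Fin n)
    (w : EuclideanSpace ℝ (Fin d)) :
    bMatchCost p (Function.update x i w) y - bMatchCost p x y ≤
      p * (‖x i - y (σ i)‖ + ‖w - x i‖) ^ (p - 1) * ‖w - x i‖ := by
  have h1 := bMatchCost_le (p := p) (Function.update x i w) y σ
  have h2 : bMatchLen p (Function.update x i w) y σ - bMatchLen p x y σ =
      ‖w - y (σ i)‖ ^ p - ‖x i - y (σ i)‖ ^ p := by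
    unfold bMatchLen
    rw [← Finset.sum_sub_distrib, Finset.sum_eq_single i]
    · simp
    · intro j _ hj; simp [hj]
    · simp
  have h3 := rpow_sub_rpow_le hp (norm_nonneg (x i - y (σ i))) (norm_nonneg (w - y (σ i)))
  have h4 : |‖w - y (σ i)‖ - ‖x i - y (σ i)‖| ≤ ‖w - x i‖ := by
    simpa using abs_norm_sub_norm_le (w - y (σ i)) (x i - y (σ i))
  have h5 : p * (‖x i - y (σ i)‖ + |‖w - y (σ i)‖ - ‖x i - y (σ i)‖|) ^ (p - 1) *
      |‖w - y (σ i)‖ - ‖x i - y (σ i)‖| ≤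
      p * (‖x i - y (σ i)‖ + ‖w - x i‖) ^ (p - 1) * ‖w - x i‖ := by
    have : 0 ≤ p - 1 := by linarith
    gcongr
  linarith

/-- The direction moving the `j`-th coordinate of the `i`-th point of the first sample. -/
noncomputable def coordDir (d n : ℕ) (i : Fin n) (j : Fin d) :
    (Fin n → EuclideanSpace ℝ (Fin d)) × (Fin n → EuclideanSpace ℝ (Fin d)) :=
  (Pi.single i (EuclideanSpace.single j 1), 0)

theorem add_smul_coordDir (x y : Fin n → EuclideanSpace ℝ (Fin d)) (i : Fin n) (j : Fin d) (t : ℝ) :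
    (x, y) + t • coordDir d n i j =
      (Function.update x i (x i + t • EuclideanSpace.single j 1), y) := by
  ext k l
  · by_cases hk : k = i
    · subst hk; simp [coordDir]
    · simp [coordDir, hk]
  · simp [coordDir]

theorem abs_lineDeriv_bMatchCost_le (hp : 1 ≤ p) (x y : Fin n → EuclideanSpace ℝ (Fin d))
    {σ : Equiv.Perm (Fin n)} (hσ : bMatchLen p x y σ = bMatchCost p x y) (i : Fin n) (j : Fin d) :
    |lineDeriv ℝ (fun z : (Fin n → EuclideanSpace ℝ (Fin d)) × (Fin n → EuclideanSpace ℝ (Fin d)) =>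
      bMatchCost p z.1 z.2) (x, y) (coordDir d n i j)| ≤ p * ‖x i - y (σ i)‖ ^ (p - 1) := by
  refine abs_lineDeriv_le hp (fun t => ?_) (norm_nonneg _)
  rw [add_smul_coordDir]
  have := bMatchCost_update_sub_le hp x y hσ i (x i + t • EuclideanSpace.single j 1)
  simpa [norm_smul] using this

theorem norm_le_sqrt_mul {v : EuclideanSpace ℝ (Fin d)} {c : ℝ} (hc : 0 ≤ c)
    (h : ∀ k, |v k| ≤ c) : ‖v‖ ≤ √d * c := by
  rw [EuclideanSpace.norm_eq, ← Real.sqrt_sq hc, ← Real.sqrt_mul (by positivity)]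
  apply Real.sqrt_le_sqrt
  calc ∑ k, ‖v k‖ ^ 2 ≤ ∑ _k : Fin d, c ^ 2 :=
        Finset.sum_le_sum fun k _ => pow_le_pow_left₀ (norm_nonneg _) (h k) 2
    _ = d * c ^ 2 := by simp

theorem norm_sub_le_of_mem_unitCube {v w : EuclideanSpace ℝ (Fin d)} (hv : v ∈ unitCube d)
    (hw : w ∈ unitCube d) : ‖v - w‖ ≤ √d := by
  have := norm_le_sqrt_mul (v := v - w) zero_le_one fun k => by
    have h1 := hv k
    have h2 := hw k
    simp only [Set.mem_Icc] at h1 h2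
    rw [PiLp.sub_apply, abs_le]
    constructor <;> linarith
  simpa using this

theorem lipschitzOnWith_bMatchCost_update (hp : 1 ≤ p) {x y : Fin n → EuclideanSpace ℝ (Fin d)}
    (i : Fin n) (hy : ∀ k, y k ∈ unitCube d) :
    LipschitzOnWith (p * (2 * √d) ^ (p - 1)).toNNReal
      (fun v => bMatchCost p (Function.update x i v) y) (unitCube d) := by
  have hK : 0 ≤ p * (2 * √d) ^ (p - 1) := by positivity
  refine LipschitzOnWith.of_le_add_mul _ fun w hw v hv => ?_
  rw [Real.coe_toNNReal _ hK, dist_eq_norm]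
  obtain ⟨σ, hσ⟩ := exists_bMatchCost_eq p (Function.update x i v) y
  have h := bMatchCost_update_sub_le hp _ y hσ i w
  simp only [Function.update_idem, Function.update_self] at h
  have h1 : (‖v - y (σ i)‖ + ‖w - v‖) ^ (p - 1) ≤ (2 * √d) ^ (p - 1) := by
    refine Real.rpow_le_rpow (by positivity) ?_ (by linarith)
    have := norm_sub_le_of_mem_unitCube hv (hy (σ i))
    have := norm_sub_le_of_mem_unitCube hw hv
    linarith
  have h2 : p * (‖v - y (σ i)‖ + ‖w - v‖) ^ (p - 1) * ‖w - v‖ ≤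
      p * (2 * √d) ^ (p - 1) * ‖w - v‖ := by gcongr
  linarith

theorem abs_bMatchCost_le (hp : 1 ≤ p) {x y : Fin n → EuclideanSpace ℝ (Fin d)}
    (hx : ∀ k, x k ∈ unitCube d) (hy : ∀ k, y k ∈ unitCube d) :
    |bMatchCost p x y| ≤ n * √d ^ p := by
  obtain ⟨σ, hσ⟩ := exists_bMatchCost_eq p x y
  rw [← hσ, abs_of_nonneg (bMatchLen_nonneg x y σ)]
  calc bMatchLen p x y σ ≤ ∑ _i : Fin n, √d ^ p :=
        Finset.sum_le_sum fun i _ => Real.rpow_le_rpow (norm_nonneg _)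
          (norm_sub_le_of_mem_unitCube (hx _) (hy _)) (by linarith)
    _ = n * √d ^ p := by simp

end MatchingCost

section VarianceBound

open ProbabilityTheory

variable {d n : ℕ} {p : ℝ}

theorem ae_pi_mem_unitCube (d n : ℕ) :
    ∀ᵐ x ∂(Measure.pi fun _ : Fin n => cubeUniform d), ∀ k, x k ∈ unitCube d := by
  rw [ae_all_iff]
  intro k
  have h : ∀ᵐ v ∂(cubeUniform d), v ∈ unitCube d := ae_restrict_mem (measurableSet_unitCube d)
  exact (Measure.quasiMeasurePreserving_eval (fun _ : Fin n => cubeUniform d) k).ae h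

theorem ae_pairMeasure_mem_unitCube (d n : ℕ) :
    ∀ᵐ z ∂(pairMeasure d n), (∀ k, z.1 k ∈ unitCube d) ∧ ∀ k, z.2 k ∈ unitCube d := by
  refine Filter.Eventually.and ?_ ?_
  · exact Measure.quasiMeasurePreserving_fst.ae (ae_pi_mem_unitCube d n)
  · exact Measure.quasiMeasurePreserving_snd.ae (ae_pi_mem_unitCube d n)

/-- The matching cost, cut off outside the cube. -/
noncomputable def cubeCost (d n : ℕ) (p : ℝ)
    (z : (Fin n → EuclideanSpace ℝ (Fin d)) × (Fin n → EuclideanSpace ℝ (Fin d))) : ℝ :=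
  if (∀ k, z.1 k ∈ unitCube d) ∧ ∀ k, z.2 k ∈ unitCube d then bMatchCost p z.1 z.2 else 0

theorem measurable_cubeCost (d n : ℕ) (hp : 1 ≤ p) : Measurable (cubeCost d n p) := by
  refine Measurable.ite ?_ (continuous_bMatchCost d n hp).measurable measurable_const
  have h : {z : (Fin n → EuclideanSpace ℝ (Fin d)) × (Fin n → EuclideanSpace ℝ (Fin d)) |
      (∀ k, z.1 k ∈ unitCube d) ∧ ∀ k, z.2 k ∈ unitCube d} =
      (⋂ k, (fun z => z.1 k) ⁻¹' unitCube d) ∩ ⋂ k, (fun z => z.2 k) ⁻¹' unitCube d := by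
    ext z; simp
  rw [h]
  exact (MeasurableSet.iInter fun k => (measurableSet_unitCube d).preimage (by fun_prop)).inter
    (MeasurableSet.iInter fun k => (measurableSet_unitCube d).preimage (by fun_prop))

theorem abs_cubeCost_le (hp : 1 ≤ p)
    (z : (Fin n → EuclideanSpace ℝ (Fin d)) × (Fin n → EuclideanSpace ℝ (Fin d))) :
    |cubeCost d n p z| ≤ n * √d ^ p := by
  unfold cubeCost
  split_ifs with h
  · exact abs_bMatchCost_le hp h.1 h.2
  · rw [abs_zero]; positivity

theorem cubeCost_swap (x y : Fin n → EuclideanSpace ℝ (Fin d)) :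
    cubeCost d n p (x, y) = cubeCost d n p (y, x) := by
  unfold cubeCost
  simp only [bMatchCost_comm x y, and_comm]

/-- The squared norm of the gradient of the matching cost in the first sample. -/
noncomputable def gradSq (d n : ℕ) (p : ℝ)
    (z : (Fin n → EuclideanSpace ℝ (Fin d)) × (Fin n → EuclideanSpace ℝ (Fin d)))
    (i : Fin n) : ENNReal :=
  ∑ j, ‖lineDeriv ℝ
    (fun z : (Fin n → EuclideanSpace ℝ (Fin d)) × (Fin n → EuclideanSpace ℝ (Fin d)) =>
      bMatchCost p z.1 z.2) z (coordDir d n i j)‖ₑ ^ 2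

theorem measurable_gradSq (d n : ℕ) (hp : 1 ≤ p) (i : Fin n) :
    Measurable fun z => gradSq d n p z i :=
  Finset.measurable_fun_sum _ fun _ _ =>
    ((measurable_lineDeriv (continuous_bMatchCost d n hp)).enorm).pow_const 2

theorem evariance_cubeCost_slice_le (hp : 1 ≤ p) (y : Fin n → EuclideanSpace ℝ (Fin d)) :
    evariance (fun x => cubeCost d n p (x, y)) (Measure.pi fun _ => cubeUniform d) ≤
      ∑ i, ∫⁻ x, gradSq d n p (x, y) i ∂(Measure.pi fun _ => cubeUniform d) := by
  refine evariance_pi_le (cubeUniform d) n (fun x => cubeCost d n p (x, y))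
    ((measurable_cubeCost d n hp).comp measurable_prodMk_right) _
    (fun x => abs_cubeCost_le hp _) (fun i x => gradSq d n p (x, y) i)
    (fun i => (measurable_gradSq d n hp i).comp measurable_prodMk_right) fun z i => ?_
  by_cases h : (∀ k, k ≠ i → z k ∈ unitCube d) ∧ ∀ k, y k ∈ unitCube d
  · have hae : (fun t => cubeCost d n p (Function.update z i t, y)) =ᵐ[cubeUniform d]
        fun t => bMatchCost p (Function.update z i t) y := by
      filter_upwards [ae_restrict_mem (measurableSet_unitCube d)] with t ht
      refine if_pos ⟨fun k => ?_, h.2⟩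
      by_cases hk : k = i
      · subst hk; simpa using ht
      · simpa [hk] using h.1 k hk
    rw [evariance_congr hae]
    have hu : Continuous fun t => (Function.update z i t, y) := by fun_prop
    have hc : Continuous fun t => bMatchCost p (Function.update z i t) y := by
      simpa only [Function.comp_def] using (continuous_bMatchCost d n hp).comp hu
    refine (evariance_cubeUniform_le hc (lipschitzOnWith_bMatchCost_update hp i h.2)).trans ?_
    rw [← lintegral_finsetSum' _ fun _ _ =>
      (((measurable_lineDeriv hc).enorm).pow_const 2).aemeasurable]
    refine (lintegral_congr fun t => ?_).le
    unfold gradSq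
    refine Finset.sum_congr rfl fun j _ => ?_
    simp only [lineDeriv, add_smul_coordDir, Function.update_self, Function.update_idem]
  · have h0 : (fun t => cubeCost d n p (Function.update z i t, y)) = 0 := by
      funext t
      refine if_neg fun h' => h ⟨fun k hk => ?_, h'.2⟩
      simpa [hk] using h'.1 k
    rw [h0, evariance_zero]
    exact zero_le

theorem evariance_bMatchCost_le (d n : ℕ) (hp : 1 ≤ p) :
    evariance (fun z => bMatchCost p z.1 z.2) (pairMeasure d n) ≤
      2 * ∫⁻ z, ∑ i, gradSq d n p z i ∂(pairMeasure d n) := by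
  have hae : (fun z => bMatchCost p z.1 z.2) =ᵐ[pairMeasure d n] cubeCost d n p := by
    filter_upwards [ae_pairMeasure_mem_unitCube d n] with z hz
    exact (if_pos hz).symm
  have hm : ∀ i, Measurable fun z => gradSq d n p z i := measurable_gradSq d n hp
  have key : ∫⁻ y, evariance (fun x => cubeCost d n p (x, y))
        (Measure.pi fun _ => cubeUniform d) ∂(Measure.pi fun _ : Fin n => cubeUniform d) ≤
      ∫⁻ z, ∑ i, gradSq d n p z i ∂(pairMeasure d n) := by
    rw [pairMeasure,
      lintegral_prod_symm _ (Finset.measurable_fun_sum _ fun i _ => hm i).aemeasurable]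
    refine lintegral_mono fun y => (evariance_cubeCost_slice_le hp y).trans_eq ?_
    exact (lintegral_finsetSum _ fun i _ => (hm i).comp measurable_prodMk_right).symm
  rw [evariance_congr hae, two_mul]
  refine (evariance_prod_le (measurable_cubeCost d n hp) (abs_cubeCost_le hp)).trans ?_
  refine add_le_add ?_ key
  have hs : ∀ x : Fin n → EuclideanSpace ℝ (Fin d), (fun y => cubeCost d n p (x, y)) =
      fun y => cubeCost d n p (y, x) := fun x => funext fun y => cubeCost_swap x y
  simp_rw [hs]
  exact key

/-- Edge lengths of an optimal matching control the gradient. -/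
theorem sum_gradSq_le (hp : 1 ≤ p) (x y : Fin n → EuclideanSpace ℝ (Fin d))
    {σ : Equiv.Perm (Fin n)} (hσ : bMatchLen p x y σ = bMatchCost p x y) :
    ∑ i, gradSq d n p (x, y) i ≤
      ENNReal.ofReal (d * p ^ 2 * ∑ i, ‖x i - y (σ i)‖ ^ (2 * p - 2)) := by
  rw [Finset.mul_sum, ENNReal.ofReal_sum_of_nonneg fun i _ => by positivity]
  refine Finset.sum_le_sum fun i _ => ?_
  have h : ∀ j, ‖lineDeriv ℝ (fun z : (Fin n → EuclideanSpace ℝ (Fin d)) ×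
      (Fin n → EuclideanSpace ℝ (Fin d)) => bMatchCost p z.1 z.2) (x, y) (coordDir d n i j)‖ₑ ^ 2 ≤
      ENNReal.ofReal (p ^ 2 * ‖x i - y (σ i)‖ ^ (2 * p - 2)) := fun j => by
    rw [← ofReal_norm, ← ENNReal.ofReal_pow (norm_nonneg _), Real.norm_eq_abs]
    apply ENNReal.ofReal_le_ofReal
    have := pow_le_pow_left₀ (abs_nonneg _) (abs_lineDeriv_bMatchCost_le hp x y hσ i j) 2
    rw [mul_pow, ← Real.rpow_mul_natCast (norm_nonneg _)] at this
    rwa [show (p - 1) * ((2 : ℕ) : ℝ) = 2 * p - 2 by push_cast; ring] at this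
  refine (Finset.sum_le_sum fun j _ => h j).trans ?_
  rw [Finset.sum_const, Finset.card_univ, Fintype.card_fin, ← ENNReal.ofReal_nsmul, nsmul_eq_mul,
    mul_assoc]

instance isProbabilityMeasure_pairMeasure (d n : ℕ) : IsProbabilityMeasure (pairMeasure d n) := by
  unfold pairMeasure; infer_instance

/-- Variance bound for a matching cost whose optimal edges are short off an exceptional set. -/
theorem evariance_bMatchCost_le_of_good (hp : 1 ≤ p) {c : ℝ}
    (S : Set ((Fin n → EuclideanSpace ℝ (Fin d)) × (Fin n → EuclideanSpace ℝ (Fin d))))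
    (h : ∀ x y : Fin n → EuclideanSpace ℝ (Fin d), (∀ k, x k ∈ unitCube d) →
      (∀ k, y k ∈ unitCube d) → (x, y) ∉ S → ∀ σ, bMatchLen p x y σ = bMatchCost p x y →
      ∑ i, ‖x i - y (σ i)‖ ^ (2 * p - 2) ≤ c) :
    evariance (fun z => bMatchCost p z.1 z.2) (pairMeasure d n) ≤
      2 * (ENNReal.ofReal (d * p ^ 2 * c) +
        ENNReal.ofReal (d * p ^ 2 * (n * √d ^ (2 * p - 2))) * pairMeasure d n S) := by
  refine (evariance_bMatchCost_le d n hp).trans ?_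
  gcongr
  calc ∫⁻ z, ∑ i, gradSq d n p z i ∂(pairMeasure d n)
      ≤ ∫⁻ z, (ENNReal.ofReal (d * p ^ 2 * c) + S.indicator (fun _ =>
          ENNReal.ofReal (d * p ^ 2 * (n * √d ^ (2 * p - 2)))) z) ∂(pairMeasure d n) := by
        refine lintegral_mono_ae ?_
        filter_upwards [ae_pairMeasure_mem_unitCube d n] with z hz
        obtain ⟨x, y⟩ := z
        obtain ⟨σ, hσ⟩ := exists_bMatchCost_eq p x y
        refine (sum_gradSq_le hp x y hσ).trans ?_
        by_cases hS : (x, y) ∈ S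
        · rw [Set.indicator_of_mem hS]
          refine le_add_left (ENNReal.ofReal_le_ofReal ?_)
          gcongr
          calc ∑ i, ‖x i - y (σ i)‖ ^ (2 * p - 2) ≤ ∑ _i : Fin n, √d ^ (2 * p - 2) :=
                Finset.sum_le_sum fun i _ => Real.rpow_le_rpow (norm_nonneg _)
                  (norm_sub_le_of_mem_unitCube (hz.1 _) (hz.2 _)) (by linarith)
            _ = n * √d ^ (2 * p - 2) := by simp
        · refine le_add_right (ENNReal.ofReal_le_ofReal ?_)
          gcongr
          exact h x y hz.1 hz.2 hS σ hσ
    _ ≤ _ := by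
        rw [lintegral_add_left measurable_const, lintegral_const, measure_univ, mul_one]
        gcongr
        exact lintegral_indicator_const_le _ _

end VarianceBound

section Multiscale

variable {d : ℕ}

/-- Binary logarithm of the `i`-th side of a dyadic box with `2 ^ t` cells, when the sides are
doubled cyclically. -/
def sideExp (d t : ℕ) (i : Fin d) : ℕ := (t + (d - 1 - i)) / d

/-- The set of grid cells of the dyadic box with `2 ^ t` cells and index `b`. -/
def dyadicBox (t : ℕ) (b : Fin d → ℕ) : Finset (Fin d → ℕ) :=
  Fintype.piFinset fun i => Finset.Ico (b i * 2 ^ sideExp d t i) ((b i + 1) * 2 ^ sideExp d t i)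

theorem mem_dyadicBox {t : ℕ} {b c : Fin d → ℕ} :
    c ∈ dyadicBox t b ↔ ∀ i, c i / 2 ^ sideExp d t i = b i := by
  simp only [dyadicBox, Fintype.mem_piFinset, Finset.mem_Ico]
  refine forall_congr' fun i => ?_
  rw [Nat.div_eq_iff (by positivity)]
  have : 0 < 2 ^ sideExp d t i := by positivity
  rw [add_mul, one_mul, Nat.le_sub_one_iff_lt (by omega)]

theorem sideExp_zero (i : Fin d) : sideExp d 0 i = 0 :=
  Nat.div_eq_of_lt (by omega)

theorem sideExp_mul (K : ℕ) (i : Fin d) : sideExp d (K * d) i = K := by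
  unfold sideExp
  have hi := i.isLt
  rw [add_comm, Nat.add_mul_div_right _ _ (by omega), Nat.div_eq_of_lt (by omega), zero_add]

theorem sideExp_mod (t : ℕ) (r : Fin d) (hr : (r : ℕ) = t % d) : sideExp d t r = t / d := by
  unfold sideExp
  have h := Nat.div_add_mod t d
  have hd : 0 < d := r.pos
  have : t + (d - 1 - r) = (d - 1) + (t / d) * d := by
    have := r.isLt
    rw [mul_comm (t / d)]
    omega
  rw [this, Nat.add_mul_div_right _ _ hd, Nat.div_eq_of_lt (by omega), zero_add]

theorem sideExp_succ (t : ℕ) (r i : Fin d) (hr : (r : ℕ) = t % d) :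
    sideExp d (t + 1) i = sideExp d t i + if i = r then 1 else 0 := by
  have hi := i.isLt
  unfold sideExp
  rw [add_right_comm, Nat.succ_div]
  congr 1
  refine if_congr ?_ rfl rfl
  have h := Nat.div_add_mod t d
  have e : t + (d - 1 - i) + 1 = (t % d + (d - i)) + d * (t / d) := by omega
  have hm : t % d < d := Nat.mod_lt _ (by omega)
  rw [e, Nat.dvd_add_left (Dvd.intro _ rfl), Fin.ext_iff, hr]
  constructor
  · rintro ⟨k, hk⟩
    have : k = 1 := by
      rcases k with _ | _ | k
      · omega
      · rfl
      · exfalso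
        have : d * (k + 1 + 1) = d * k + d + d := by ring
        omega
    subst this
    omega
  · intro h'
    exact ⟨1, by omega⟩

theorem sum_sideExp (hd : 0 < d) (t : ℕ) : ∑ i : Fin d, sideExp d t i = t := by
  induction t with
  | zero => simp [sideExp_zero]
  | succ t ih =>
    let r : Fin d := ⟨t % d, Nat.mod_lt _ hd⟩
    simp_rw [sideExp_succ t r _ rfl, Finset.sum_add_distrib, ih]
    simp

theorem card_dyadicBox (hd : 0 < d) (t : ℕ) (b : Fin d → ℕ) : (dyadicBox t b).card = 2 ^ t := by
  unfold dyadicBox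
  rw [Fintype.card_piFinset]
  have : ∀ i, (Finset.Ico (b i * 2 ^ sideExp d t i) ((b i + 1) * 2 ^ sideExp d t i)).card =
      2 ^ sideExp d t i := fun i => by
    rw [Nat.card_Ico, ← Nat.sub_mul, Nat.add_sub_cancel_left, one_mul]
  simp_rw [this]
  rw [Finset.prod_pow_eq_pow_sum, sum_sideExp hd]

theorem mem_dyadicBox_succ {t : ℕ} {r : Fin d} (hr : (r : ℕ) = t % d) {b c : Fin d → ℕ} :
    c ∈ dyadicBox (t + 1) b ↔
      (∀ i, i ≠ r → c i / 2 ^ sideExp d t i = b i) ∧ c r / 2 ^ sideExp d t r / 2 = b r := by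
  rw [mem_dyadicBox]
  constructor
  · intro h
    refine ⟨fun i hi => ?_, ?_⟩
    · simpa [sideExp_succ t r i hr, hi] using h i
    · have := h r
      rwa [sideExp_succ t r r hr, if_pos rfl, pow_succ, ← Nat.div_div_eq_div_mul] at this
  · rintro ⟨h1, h2⟩ i
    by_cases hi : i = r
    · subst hi
      rwa [sideExp_succ t i i hr, if_pos rfl, pow_succ, ← Nat.div_div_eq_div_mul]
    · simpa [sideExp_succ t r i hr, hi] using h1 i hi

theorem mem_dyadicBox_update {t : ℕ} {r : Fin d} {b c : Fin d → ℕ} {k : ℕ} :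
    c ∈ dyadicBox t (Function.update b r k) ↔
      (∀ i, i ≠ r → c i / 2 ^ sideExp d t i = b i) ∧ c r / 2 ^ sideExp d t r = k := by
  rw [mem_dyadicBox]
  constructor
  · intro h
    exact ⟨fun i hi => by simpa [hi] using h i, by simpa using h r⟩
  · rintro ⟨h1, h2⟩ i
    by_cases hi : i = r
    · subst hi; simpa using h2
    · simpa [hi] using h1 i hi

theorem dyadicBox_succ {t : ℕ} {r : Fin d} (hr : (r : ℕ) = t % d) (b : Fin d → ℕ) :
    dyadicBox (t + 1) b = dyadicBox t (Function.update b r (2 * b r)) ∪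
      dyadicBox t (Function.update b r (2 * b r + 1)) := by
  ext c
  rw [Finset.mem_union, mem_dyadicBox_succ hr, mem_dyadicBox_update, mem_dyadicBox_update,
    ← and_or_left]
  refine and_congr_right fun _ => ?_
  omega

theorem disjoint_dyadicBox {t : ℕ} (r : Fin d) (b : Fin d → ℕ) :
    Disjoint (dyadicBox t (Function.update b r (2 * b r)))
      (dyadicBox t (Function.update b r (2 * b r + 1))) := by
  rw [Finset.disjoint_left]
  intro c h0 h1
  rw [mem_dyadicBox_update] at h0 h1
  omega

/-- The total variation of `f` in direction `r` on a set of cells. -/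
noncomputable def dirVariation (f : (Fin d → ℕ) → ℝ) (r : Fin d) (B : Finset (Fin d → ℕ)) : ℝ :=
  ∑ c ∈ B with c + Pi.single r 1 ∈ B, |f (c + Pi.single r 1) - f c|

theorem dirVariation_nonneg (f : (Fin d → ℕ) → ℝ) (r : Fin d) (B : Finset (Fin d → ℕ)) :
    0 ≤ dirVariation f r B :=
  Finset.sum_nonneg fun _ _ => abs_nonneg _

theorem dirVariation_union (f : (Fin d → ℕ) → ℝ) (r : Fin d) {A B : Finset (Fin d → ℕ)}
    (h : Disjoint A B) : dirVariation f r A + dirVariation f r B ≤ dirVariation f r (A ∪ B) := by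
  unfold dirVariation
  rw [← Finset.sum_union (Finset.disjoint_filter_filter h)]
  refine Finset.sum_le_sum_of_subset_of_nonneg (fun c hc => ?_) fun _ _ _ => abs_nonneg _
  simp only [Finset.mem_union, Finset.mem_filter] at hc ⊢
  tauto

/-- The sums of `f` over the two halves of a box differ by at most the side times the variation. -/
theorem abs_sum_sub_sum_le {t : ℕ} {r : Fin d} (hr : (r : ℕ) = t % d) (f : (Fin d → ℕ) → ℝ)
    (b : Fin d → ℕ) :
    |∑ c ∈ dyadicBox t (Function.update b r (2 * b r + 1)), f c -
      ∑ c ∈ dyadicBox t (Function.update b r (2 * b r)), f c| ≤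
      2 ^ sideExp d t r * dirVariation f r (dyadicBox (t + 1) b) := by
  set s := 2 ^ sideExp d t r with hs
  have hs0 : 0 < s := by positivity
  set B0 := dyadicBox t (Function.update b r (2 * b r)) with hB0
  set e : Fin d → ℕ := Pi.single r 1 with he
  have hne : ∀ (k : ℕ) (c : Fin d → ℕ) i, i ≠ r → (c + k • e) i = c i := fun k c i hi => by
    simp [he, hi]
  have hr' : ∀ (k : ℕ) (c : Fin d → ℕ), (c + k • e) r = c r + k := fun k c => by simp [he]
  have hshift : ∑ c ∈ dyadicBox t (Function.update b r (2 * b r + 1)), f c =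
      ∑ c ∈ B0, f (c + s • e) := by
    symm
    refine Finset.sum_bij (fun c _ => c + s • e) (fun c hc => ?_)
      (fun c _ c' _ h => by simpa using h)
      (fun c hc => ?_) fun _ _ => rfl
    · rw [hB0, mem_dyadicBox_update] at hc
      rw [mem_dyadicBox_update, hr', ← hs, Nat.add_div_right _ hs0]
      refine ⟨fun i hi => by rw [hne _ _ _ hi, hc.1 i hi], ?_⟩
      rw [hs, hc.2]
    · rw [mem_dyadicBox_update] at hc
      have hle : s ≤ c r := by
        by_contra h
        have h1 := Nat.div_eq_of_lt (not_le.1 h)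
        have h2 := hc.2
        rw [← hs] at h2
        omega
      have hc' : c - s • e + s • e = c := by
        ext i
        by_cases hi : i = r
        · subst hi; simp [he, hle]
        · simp [he, hi]
      refine ⟨c - s • e, ?_, hc'⟩
      have hcr := hr' s (c - s • e)
      rw [hc'] at hcr
      rw [hB0, mem_dyadicBox_update]
      refine ⟨fun i hi => ?_, ?_⟩
      · rw [← hne s (c - s • e) i hi, hc', hc.1 i hi]
      · have h2 := hc.2
        rw [hcr, ← hs, Nat.add_div_right _ hs0] at h2
        rw [← hs]; omega
  rw [hshift, ← Finset.sum_sub_distrib]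
  have htel : ∀ c, f (c + s • e) - f c =
      ∑ k ∈ Finset.range s, (f (c + k • e + e) - f (c + k • e)) := fun c => by
    have := Finset.sum_range_sub (fun k => f (c + k • e)) s
    simp only [zero_smul, add_zero, succ_nsmul, ← add_assoc] at this
    exact this.symm
  simp_rw [htel]
  rw [Finset.sum_comm]
  refine (Finset.abs_sum_le_sum_abs _ _).trans ?_
  calc ∑ k ∈ Finset.range s, |∑ c ∈ B0, (f (c + k • e + e) - f (c + k • e))|
      ≤ ∑ _k ∈ Finset.range s, dirVariation f r (dyadicBox (t + 1) b) := by
        refine Finset.sum_le_sum fun k hk => (Finset.abs_sum_le_sum_abs _ _).trans ?_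
        rw [Finset.mem_range] at hk
        have hinj : Function.Injective fun c : Fin d → ℕ => c + k • e := add_left_injective _
        rw [← Finset.sum_image (f := fun c => |f (c + e) - f c|) (g := fun c => c + k • e)
          hinj.injOn]
        refine Finset.sum_le_sum_of_subset_of_nonneg (fun c' hc' => ?_) fun _ _ _ => abs_nonneg _
        obtain ⟨c, hc, rfl⟩ := Finset.mem_image.1 hc'
        rw [hB0, mem_dyadicBox_update] at hc
        have hmem : ∀ k ≤ s, c + k • e ∈ dyadicBox (t + 1) b := fun k hk => by
          rw [mem_dyadicBox_succ hr, hr']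
          refine ⟨fun i hi => by rw [hne _ _ _ hi, hc.1 i hi], ?_⟩
          rw [← hs, ← hs] at *
          have h1 : c r / s ≤ (c r + k) / s := Nat.div_le_div_right (by omega)
          have h2 : (c r + k) / s ≤ (c r + s) / s := Nat.div_le_div_right (by omega)
          rw [Nat.add_div_right _ hs0] at h2
          omega
        rw [Finset.mem_filter]
        refine ⟨hmem k hk.le, ?_⟩
        rw [add_assoc, ← succ_nsmul]
        exact hmem (k + 1) hk
    _ = _ := by simp [hs]

/-- A signed measure with square-root discrepancies on all dyadic boxes acts on functions through
their total variation. -/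
theorem abs_sum_mul_sub_le (hd : 2 ≤ d) (D f : (Fin d → ℕ) → ℝ) {δ : ℝ} (hδ : 0 ≤ δ) (t : ℕ)
    (hD : ∀ k < t, ∀ b : Fin d → ℕ, |∑ c ∈ dyadicBox k b, D c| ≤ δ * √(2 ^ k)) (b : Fin d → ℕ) :
    |∑ c ∈ dyadicBox t b, f c * D c -
      (∑ c ∈ dyadicBox t b, f c) / 2 ^ t * ∑ c ∈ dyadicBox t b, D c| ≤
      t * δ * ∑ r, dirVariation f r (dyadicBox t b) := by
  induction t generalizing b with
  | zero =>
    obtain ⟨c, hc⟩ := Finset.card_eq_one.1 (card_dyadicBox (by omega) 0 b)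
    simp [hc]
  | succ t ih =>
    obtain ⟨r, hr⟩ : ∃ r : Fin d, (r : ℕ) = t % d := ⟨⟨t % d, Nat.mod_lt _ (by omega)⟩, rfl⟩
    have hdisj := disjoint_dyadicBox (t := t) r b
    have ih0 := ih (fun k hk => hD k (by omega)) (Function.update b r (2 * b r))
    have ih1 := ih (fun k hk => hD k (by omega)) (Function.update b r (2 * b r + 1))
    have hS := abs_sum_sub_sum_le hr f b
    have hD0 := hD t (by omega) (Function.update b r (2 * b r))
    have hD1 := hD t (by omega) (Function.update b r (2 * b r + 1))
    have hV : ∀ r', dirVariation f r' (dyadicBox t (Function.update b r (2 * b r))) +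
        dirVariation f r' (dyadicBox t (Function.update b r (2 * b r + 1))) ≤
        dirVariation f r' (dyadicBox (t + 1) b) := fun r' => by
      rw [dyadicBox_succ hr]; exact dirVariation_union f r' hdisj
    have hVs := Finset.sum_le_sum fun r' (_ : r' ∈ Finset.univ) => hV r'
    rw [Finset.sum_add_distrib] at hVs
    have hE : dirVariation f r (dyadicBox (t + 1) b) ≤
        ∑ r', dirVariation f r' (dyadicBox (t + 1) b) :=
      Finset.single_le_sum (f := fun r' => dirVariation f r' (dyadicBox (t + 1) b))
        (fun r' _ => dirVariation_nonneg f r' _) (Finset.mem_univ r)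
    have hEr := dirVariation_nonneg f r (dyadicBox (t + 1) b)
    have hs : (2 : ℝ) ^ sideExp d t r ≤ √(2 ^ t) := by
      rw [sideExp_mod t r hr]
      apply Real.le_sqrt_of_sq_le
      rw [← pow_mul]
      refine pow_le_pow_right₀ one_le_two ?_
      calc t / d * 2 ≤ t / d * d := Nat.mul_le_mul_left _ hd
        _ ≤ t := Nat.div_mul_le_self t d
    generalize hE' : dirVariation f r (dyadicBox (t + 1) b) = Er at *
    generalize ∑ r', dirVariation f r' (dyadicBox (t + 1) b) = E at *
    rw [dyadicBox_succ hr, Finset.sum_union hdisj, Finset.sum_union hdisj, Finset.sum_union hdisj]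
    generalize dyadicBox t (Function.update b r (2 * b r)) = B0 at *
    generalize dyadicBox t (Function.update b r (2 * b r + 1)) = B1 at *
    generalize ∑ c ∈ B0, f c * D c = P0 at *
    generalize ∑ c ∈ B1, f c * D c = P1 at *
    generalize ∑ c ∈ B0, f c = S0 at *
    generalize ∑ c ∈ B1, f c = S1 at *
    generalize ∑ c ∈ B0, D c = D0 at *
    generalize ∑ c ∈ B1, D c = D1 at *
    generalize ∑ r, dirVariation f r B0 = E0 at *
    generalize ∑ r, dirVariation f r B1 = E1 at *
    generalize (2 : ℝ) ^ sideExp d t r = s at *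
    have hM : (0 : ℝ) < 2 ^ t := by positivity
    have hsq : √(2 ^ t : ℝ) * √(2 ^ t) = 2 ^ t := Real.mul_self_sqrt hM.le
    rw [pow_succ]
    generalize (2 : ℝ) ^ t = M at *
    have hcross : |(S1 - S0) / (M * 2) * (D1 - D0)| ≤ δ * E := by
      have h1 : |D1 - D0| ≤ 2 * (δ * √M) := (abs_sub _ _).trans (by linarith)
      have h2 : |S1 - S0| ≤ √M * E := hS.trans (by gcongr)
      rw [abs_mul, abs_div, abs_of_pos (show 0 < M * 2 by positivity), div_mul_eq_mul_div,
        div_le_iff₀ (by positivity)]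
      calc |S1 - S0| * |D1 - D0| ≤ (√M * E) * (2 * (δ * √M)) :=
          mul_le_mul h2 h1 (abs_nonneg _) ((abs_nonneg _).trans h2)
        _ = δ * E * (√M * √M * 2) := by ring
        _ = _ := by rw [hsq]
    have key : P0 + P1 - (S0 + S1) / (M * 2) * (D0 + D1) =
        (P0 - S0 / M * D0) + (P1 - S1 / M * D1) + (S1 - S0) / (M * 2) * (D1 - D0) := by
      field_simp; ring
    rw [key]
    have h3 : t * δ * (E0 + E1) ≤ t * δ * E := by gcongr
    push_cast
    calc _ ≤ |P0 - S0 / M * D0| + |P1 - S1 / M * D1| + |(S1 - S0) / (M * 2) * (D1 - D0)| :=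
          (abs_add_le _ _).trans (by gcongr; exact abs_add_le _ _)
      _ ≤ t * δ * E0 + t * δ * E1 + δ * E := by linarith
      _ ≤ (t + 1) * δ * E := by linarith

end Multiscale

section RegularSamples

variable {d n : ℕ}

/-- The index of the dyadic box with sides `2 ^ (-m i)` containing a point of the unit cube. -/
noncomputable def gridCell (m : Fin d → ℕ) (u : EuclideanSpace ℝ (Fin d)) : Fin d → ℕ :=
  fun i => ⌊2 ^ m i * u i⌋₊

/-- The number of sample points in a dyadic box. -/
noncomputable def boxCount (m b : Fin d → ℕ) (x : Fin n → EuclideanSpace ℝ (Fin d)) : ℕ :=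
  (Finset.univ.filter fun k => gridCell m (x k) = b).card

/-- A sample whose counts in all dyadic boxes of resolution at most `K` are within `L` standard
deviations of their means. -/
def IsRegularSample (K : ℕ) (L : ℝ) (x : Fin n → EuclideanSpace ℝ (Fin d)) : Prop :=
  (∀ k i, x k i ∈ Set.Ico (0 : ℝ) 1) ∧
    ∀ m b : Fin d → ℕ, (∀ i, m i ≤ K) → (∀ i, b i < 2 ^ m i) →
      |(boxCount m b x : ℝ) - n / 2 ^ ∑ i, m i| ≤ L * √(n / 2 ^ ∑ i, m i)

theorem gridCell_lt {m : Fin d → ℕ} {u : EuclideanSpace ℝ (Fin d)}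
    (hu : ∀ i, u i ∈ Set.Ico (0 : ℝ) 1) (i : Fin d) : gridCell m u i < 2 ^ m i := by
  have h := hu i
  rw [Set.mem_Ico] at h
  rw [gridCell, Nat.floor_lt (by have := h.1; positivity)]
  push_cast
  have : (0 : ℝ) < 2 ^ m i := by positivity
  nlinarith

theorem gridCell_div {K : ℕ} {κ : ℕ} (h : κ ≤ K) (t : ℝ) :
    ⌊(2 : ℝ) ^ K * t⌋₊ / 2 ^ κ = ⌊(2 : ℝ) ^ (K - κ) * t⌋₊ := by
  rw [show (2 : ℕ) ^ κ = ((2 ^ κ : ℕ)) from rfl, ← Nat.floor_div_natCast]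
  congr 1
  push_cast
  rw [pow_sub₀ _ two_ne_zero h]
  ring

theorem sideExp_le {K t : ℕ} (ht : t ≤ K * d) (i : Fin d) : sideExp d t i ≤ K := by
  have h : sideExp d t i ≤ sideExp d (K * d) i := Nat.div_le_div_right (by omega)
  rwa [sideExp_mul] at h

theorem gridCell_mem_dyadicBox {K t : ℕ} (ht : t ≤ K * d) (b : Fin d → ℕ)
    (u : EuclideanSpace ℝ (Fin d)) :
    gridCell (fun _ => K) u ∈ dyadicBox t b ↔ gridCell (fun i => K - sideExp d t i) u = b := by
  rw [mem_dyadicBox, funext_iff]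
  refine forall_congr' fun i => ?_
  rw [gridCell, gridCell, gridCell_div (sideExp_le ht i)]

theorem sum_boxCount (C : Finset (Fin d → ℕ)) (m : Fin d → ℕ)
    (x : Fin n → EuclideanSpace ℝ (Fin d)) :
    ∑ c ∈ C, boxCount m c x = (Finset.univ.filter fun k => gridCell m (x k) ∈ C).card :=
  Finset.sum_card_fiberwise_eq_card_filter _ _ _

theorem sum_boxCount_dyadicBox {K t : ℕ} (ht : t ≤ K * d) (b : Fin d → ℕ)
    (x : Fin n → EuclideanSpace ℝ (Fin d)) :
    ∑ c ∈ dyadicBox t b, boxCount (fun _ => K) c x = boxCount (fun i => K - sideExp d t i) b x := by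
  rw [sum_boxCount, boxCount]
  simp_rw [gridCell_mem_dyadicBox ht]

theorem sum_sub_sideExp (hd : 0 < d) {K t : ℕ} (ht : t ≤ K * d) :
    ∑ i : Fin d, (K - sideExp d t i) = K * d - t := by
  rw [Finset.sum_tsub_distrib _ fun i _ => sideExp_le ht i, sum_sideExp hd]
  simp [mul_comm]

theorem abs_sum_boxCount_sub_le (hd : 0 < d) {K : ℕ} {L : ℝ} (hL : 0 ≤ L)
    {x y : Fin n → EuclideanSpace ℝ (Fin d)} (hx : IsRegularSample K L x)
    (hy : IsRegularSample K L y) {t : ℕ} (ht : t ≤ K * d) (b : Fin d → ℕ) :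
    |∑ c ∈ dyadicBox t b, ((boxCount (fun _ => K) c x : ℝ) - boxCount (fun _ => K) c y)| ≤
      2 * L * √(n / 2 ^ (K * d)) * √(2 ^ t) := by
  rw [Finset.sum_sub_distrib, ← Nat.cast_sum, ← Nat.cast_sum, sum_boxCount_dyadicBox ht,
    sum_boxCount_dyadicBox ht]
  by_cases hb : ∀ i, b i < 2 ^ (K - sideExp d t i)
  · have h1 := hx.2 _ b (fun i => Nat.sub_le _ _) hb
    have h2 := hy.2 _ b (fun i => Nat.sub_le _ _) hb
    have e : (n : ℝ) / 2 ^ (K * d - t) = n / 2 ^ (K * d) * 2 ^ t := by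
      rw [pow_sub₀ _ two_ne_zero ht]; field_simp
    rw [sum_sub_sideExp hd ht, e] at h1 h2
    rw [mul_assoc, ← Real.sqrt_mul (by positivity)]
    rw [abs_le] at *
    constructor <;> linarith
  · have h0 : ∀ z : Fin n → EuclideanSpace ℝ (Fin d), IsRegularSample K L z →
        boxCount (fun i => K - sideExp d t i) b z = 0 := fun z hz => by
      rw [boxCount, Finset.card_eq_zero, Finset.filter_eq_empty_iff]
      rintro k _ rfl
      exact hb fun i => gridCell_lt (hz.1 k) i
    rw [h0 x hx, h0 y hy, sub_self, abs_zero]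
    positivity

theorem dirVariation_indicator_le {G U V : Finset (Fin d → ℕ)} (r : Fin d)
    (hV : ∀ c ∈ G, c + Pi.single r 1 ∈ G → (c ∈ U ↔ ¬ c + Pi.single r 1 ∈ U) →
      c ∈ V ∨ c + Pi.single r 1 ∈ V) :
    dirVariation (fun c => if c ∈ U then 1 else 0) r G ≤ 2 * V.card := by
  calc dirVariation (fun c => if c ∈ U then 1 else 0) r G
      ≤ ∑ c ∈ G with c + Pi.single r 1 ∈ G,
          ((if c ∈ V then (1 : ℝ) else 0) + if c + Pi.single r 1 ∈ V then 1 else 0) := by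
        refine Finset.sum_le_sum fun c hc => ?_
        rw [Finset.mem_filter] at hc
        have := hV c hc.1 hc.2
        by_cases h1 : c ∈ U <;> by_cases h2 : c + Pi.single r 1 ∈ U <;>
          by_cases h3 : c ∈ V <;> by_cases h4 : c + Pi.single r 1 ∈ V <;> simp_all
    _ ≤ V.card + V.card := by
        rw [Finset.sum_add_distrib, Finset.sum_boole, Finset.sum_boole]
        refine add_le_add (Nat.cast_le.2 (Finset.card_le_card fun c hc => ?_)) (Nat.cast_le.2 ?_)
        · exact (Finset.mem_filter.1 hc).2
        · have hinj : Function.Injective fun c : Fin d → ℕ => c + Pi.single r 1 :=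
            add_left_injective _
          exact Finset.card_le_card_of_injOn _ (fun c hc => (Finset.mem_filter.1 hc).2) hinj.injOn
    _ = _ := by ring

theorem norm_sub_le_of_gridCell_near {K : ℕ} {u v : EuclideanSpace ℝ (Fin d)}
    (hu : ∀ i, 0 ≤ u i) (hv : ∀ i, 0 ≤ v i) {a : ℕ}
    (h : ∀ i, gridCell (fun _ => K) u i ≤ gridCell (fun _ => K) v i + a ∧
      gridCell (fun _ => K) v i ≤ gridCell (fun _ => K) u i + a) :
    ‖u - v‖ ≤ √d * ((a + 1) / 2 ^ K) := by
  refine norm_le_sqrt_mul (by positivity) fun i => ?_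
  have h1 := (h i).1
  have h2 := (h i).2
  simp only [gridCell] at h1 h2
  have hK : (0 : ℝ) < 2 ^ K := by positivity
  have a1 := Nat.floor_le (show 0 ≤ (2 : ℝ) ^ K * u i by have := hu i; positivity)
  have a2 := Nat.floor_le (show 0 ≤ (2 : ℝ) ^ K * v i by have := hv i; positivity)
  have a3 := Nat.lt_floor_add_one ((2 : ℝ) ^ K * u i)
  have a4 := Nat.lt_floor_add_one ((2 : ℝ) ^ K * v i)
  have h1' : (⌊(2 : ℝ) ^ K * u i⌋₊ : ℝ) ≤ ⌊(2 : ℝ) ^ K * v i⌋₊ + a := by exact_mod_cast h1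
  have h2' : (⌊(2 : ℝ) ^ K * v i⌋₊ : ℝ) ≤ ⌊(2 : ℝ) ^ K * u i⌋₊ + a := by exact_mod_cast h2
  rw [le_div_iff₀ hK, ← abs_of_pos hK, ← abs_mul, abs_le, PiLp.sub_apply, sub_mul]
  constructor <;> linarith

/-- Regular samples have a matching all of whose edges are short. -/
theorem exists_perm_norm_le (hd : 2 ≤ d) {K : ℕ} {L : ℝ} (hL : 0 ≤ L)
    {x y : Fin n → EuclideanSpace ℝ (Fin d)} (hx : IsRegularSample K L x)
    (hy : IsRegularSample K L y) (hL1 : 2 * L ≤ √(n / 2 ^ (K * d)))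
    (hL2 : 8 * d ^ 2 * K * L ≤ √(n / 2 ^ (K * d))) :
    ∃ σ : Equiv.Perm (Fin n), ∀ i, ‖x i - y (σ i)‖ ≤ √d * (2 / 2 ^ K) := by
  set N : ℝ := n / 2 ^ (K * d) with hN
  have hN0 : 0 ≤ N := by positivity
  have hNs : √N * √N = N := Real.mul_self_sqrt hN0
  set m : Fin d → ℕ := fun _ => K with hm
  set near : (Fin d → ℕ) → (Fin d → ℕ) → Prop := fun c c' => ∀ l, c l ≤ c' l + 1 ∧ c' l ≤ c l + 1
    with hnear
  have hHall : ∀ A : Finset (Fin n), A.card ≤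
      (A.biUnion fun i => Finset.univ.filter fun j =>
        near (gridCell m (x i)) (gridCell m (y j))).card := by
    intro A
    set G : Finset (Fin d → ℕ) := dyadicBox (K * d) 0 with hG
    have hGmem : ∀ c, c ∈ G ↔ ∀ i, c i < 2 ^ K := fun c => by
      simp only [hG, mem_dyadicBox, sideExp_mul, Pi.zero_apply,
        Nat.div_eq_zero_iff_lt (show 0 < 2 ^ K by positivity)]
    have hGx : ∀ z : Fin n → EuclideanSpace ℝ (Fin d), IsRegularSample K L z →
        ∀ k, gridCell m (z k) ∈ G := fun z hz k => (hGmem _).2 (gridCell_lt (hz.1 k))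
    have hGsum : ∀ z : Fin n → EuclideanSpace ℝ (Fin d), IsRegularSample K L z →
        ∑ c ∈ G, boxCount m c z = n := fun z hz => by
      rw [sum_boxCount, Finset.filter_true_of_mem fun k _ => hGx z hz k]
      simp
    set U := A.image fun i => gridCell m (x i) with hU
    set V := G.filter fun c' => c' ∉ U ∧ ∃ c ∈ U, near c c' with hV
    have hUG : U ⊆ G := by
      intro c hc
      obtain ⟨i, _, rfl⟩ := Finset.mem_image.1 hc
      exact hGx x hx i
    have hUV : Disjoint U V := by
      rw [Finset.disjoint_left]
      intro c hc hc'
      exact (Finset.mem_filter.1 hc').2.1 hc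
    have hA : A.card ≤ ∑ c ∈ U, boxCount m c x := by
      rw [sum_boxCount]
      exact Finset.card_le_card fun i hi =>
        Finset.mem_filter.2 ⟨Finset.mem_univ _, Finset.mem_image_of_mem _ hi⟩
    have hB : ∑ c ∈ U, boxCount m c y + ∑ c ∈ V, boxCount m c y ≤
        (A.biUnion fun i => Finset.univ.filter fun j =>
          near (gridCell m (x i)) (gridCell m (y j))).card := by
      rw [← Finset.sum_union hUV, sum_boxCount]
      refine Finset.card_le_card fun j hj => ?_
      have hj' : ∃ c ∈ U, near c (gridCell m (y j)) := by
        rcases Finset.mem_union.1 (Finset.mem_filter.1 hj).2 with h | h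
        · exact ⟨_, h, fun l => ⟨by omega, by omega⟩⟩
        · exact (Finset.mem_filter.1 h).2.2
      obtain ⟨c, hc, hcj⟩ := hj'
      obtain ⟨i, hi, rfl⟩ := Finset.mem_image.1 hc
      exact Finset.mem_biUnion.2 ⟨i, hi, Finset.mem_filter.2 ⟨Finset.mem_univ _, hcj⟩⟩
    have hVy : (V.card : ℝ) * (N / 2) ≤ ∑ c ∈ V, (boxCount m c y : ℝ) := by
      rw [← nsmul_eq_mul]
      refine Finset.card_nsmul_le_sum _ _ _ fun c hc => ?_
      have h := hy.2 m c (fun _ => le_rfl) ((hGmem c).1 (Finset.mem_filter.1 hc).1)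
      rw [hm, Finset.sum_const, Finset.card_univ, Fintype.card_fin, smul_eq_mul, mul_comm d K,
        ← hN] at h
      have := (abs_le.1 h).1
      have h3 : 2 * L * √N ≤ √N * √N := by gcongr
      rw [hm]
      linarith
    set f : (Fin d → ℕ) → ℝ := fun c => if c ∈ U then 1 else 0 with hf
    set D : (Fin d → ℕ) → ℝ := fun c => (boxCount m c x : ℝ) - boxCount m c y with hD
    have hvar := abs_sum_mul_sub_le hd D f (δ := 2 * L * √N) (by positivity) (K * d)
      (fun k hk b => abs_sum_boxCount_sub_le (by omega) hL hx hy hk.le b) 0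
    have hD0 : ∑ c ∈ G, D c = 0 := by
      rw [hD, Finset.sum_sub_distrib, ← Nat.cast_sum, ← Nat.cast_sum, hGsum x hx, hGsum y hy,
        sub_self]
    have hfD : ∑ c ∈ G, f c * D c =
        ∑ c ∈ U, (boxCount m c x : ℝ) - ∑ c ∈ U, (boxCount m c y : ℝ) := by
      rw [← Finset.sum_sub_distrib]
      simp only [hf, ite_mul, one_mul, zero_mul]
      rw [← Finset.sum_filter, Finset.filter_mem_eq_inter, Finset.inter_eq_right.2 hUG]
    have hdir : ∑ r, dirVariation f r G ≤ d * (2 * V.card) := by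
      calc ∑ r, dirVariation f r G ≤ ∑ _r : Fin d, (2 * (V.card : ℝ)) := by
            refine Finset.sum_le_sum fun r _ => dirVariation_indicator_le r fun c hc hc' hiff => ?_
            have hn : near c (c + Pi.single r 1) := fun l => by
              by_cases hl : l = r
              · subst hl; simp only [Pi.add_apply, Pi.single_eq_same]; omega
              · simp [hl]
            have hn' : near (c + Pi.single r 1) c := fun l => (hn l).symm
            by_cases h : c ∈ U
            · exact Or.inr (Finset.mem_filter.2 ⟨hc', hiff.1 h, c, h, hn⟩)
            · exact Or.inl (Finset.mem_filter.2 ⟨hc, h, _, not_not.1 (mt hiff.2 h), hn'⟩)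
        _ = _ := by simp
    rw [← hG, hD0, mul_zero, sub_zero, hfD] at hvar
    have h1 := (le_abs_self _).trans hvar
    have h2 : ((K * d : ℕ) : ℝ) * (2 * L * √N) * ∑ r, dirVariation f r G ≤ V.card * (N / 2) := by
      calc ((K * d : ℕ) : ℝ) * (2 * L * √N) * ∑ r, dirVariation f r G
          ≤ ((K * d : ℕ) : ℝ) * (2 * L * √N) * (d * (2 * V.card)) := by gcongr
        _ = (8 * d ^ 2 * K * L) * √N * V.card / 2 := by push_cast; ring
        _ ≤ √N * √N * V.card / 2 := by gcongr
        _ = V.card * (N / 2) := by rw [hNs]; ring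
    have hA' : (A.card : ℝ) ≤ ∑ c ∈ U, (boxCount m c x : ℝ) := by exact_mod_cast hA
    have hB' := (Nat.cast_le (α := ℝ)).2 hB
    push_cast at hB'
    exact Nat.cast_le.1 (by linarith : (A.card : ℝ) ≤ _)
  obtain ⟨f, hf, hmem⟩ := (Finset.all_card_le_biUnion_card_iff_exists_injective _).1 hHall
  refine ⟨Equiv.ofBijective f (Finite.injective_iff_bijective.1 hf), fun i => ?_⟩
  have h := (Finset.mem_filter.1 (hmem i)).2
  have := norm_sub_le_of_gridCell_near (fun l => (hx.1 i l).1) (fun l => (hy.1 (f i) l).1)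
    (a := 1) h
  simpa [one_add_one_eq_two] using this

end RegularSamples

section EdgeLengths

variable {d n : ℕ} {p : ℝ}

theorem rpow_add_rpow_le_of_optimal {x y : Fin n → EuclideanSpace ℝ (Fin d)}
    {σ : Equiv.Perm (Fin n)} (hσ : bMatchLen p x y σ = bMatchCost p x y) {a i : Fin n}
    (hai : a ≠ i) :
    ‖x a - y (σ a)‖ ^ p + ‖x i - y (σ i)‖ ^ p ≤ ‖x a - y (σ i)‖ ^ p + ‖x i - y (σ a)‖ ^ p := by
  have h := hσ.le.trans (bMatchCost_le x y (σ * Equiv.swap a i))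
  unfold bMatchLen at h
  rw [← sub_nonneg, ← Finset.sum_sub_distrib, Finset.sum_eq_add a i hai] at h
  · simp only [Equiv.Perm.mul_apply, Equiv.swap_apply_left, Equiv.swap_apply_right] at h
    linarith
  · rintro k - ⟨hka, hki⟩
    rw [Equiv.Perm.mul_apply, Equiv.swap_apply_of_ne_of_ne hka hki, sub_self]
  · simp
  · simp

/-- Near the midpoint of an edge of an optimal matching, all edges have comparable length. -/
theorem div_ten_le_of_near_midpoint (hp : 2 ≤ p) {x y : Fin n → EuclideanSpace ℝ (Fin d)}
    {σ : Equiv.Perm (Fin n)} (hσ : bMatchLen p x y σ = bMatchCost p x y) (a i : Fin n)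
    (hi : ‖x i - midpoint ℝ (x a) (y (σ a))‖ ≤ ‖x a - y (σ a)‖ / 10) :
    ‖x a - y (σ a)‖ / 10 ≤ ‖x i - y (σ i)‖ := by
  set ℓ := ‖x a - y (σ a)‖ with hℓ
  set z := midpoint ℝ (x a) (y (σ a)) with hz
  have hℓ0 : 0 ≤ ℓ := norm_nonneg _
  by_cases hai : a = i
  · subst hai; rw [← hℓ]; linarith
  by_contra! hlt
  have hpos : 0 < ℓ := by
    have := norm_nonneg (x i - y (σ i)); linarith
  have hza : ‖x a - z‖ = ℓ / 2 := by
    have := dist_left_midpoint (𝕜 := ℝ) (x a) (y (σ a))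
    rw [dist_eq_norm, dist_eq_norm] at this
    rw [hz, this, hℓ]; norm_num; ring
  have hzy : ‖z - y (σ a)‖ = ℓ / 2 := by
    have := dist_midpoint_right (𝕜 := ℝ) (x a) (y (σ a))
    rw [dist_eq_norm, dist_eq_norm] at this
    rw [hz, this, hℓ]; norm_num; ring
  have h1 : ‖x a - y (σ i)‖ ≤ 7 / 10 * ℓ := by
    calc ‖x a - y (σ i)‖ = ‖(x a - z) + (z - x i) + (x i - y (σ i))‖ := by congr 1; abel
      _ ≤ ‖x a - z‖ + ‖z - x i‖ + ‖x i - y (σ i)‖ := norm_add₃_le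
      _ ≤ 7 / 10 * ℓ := by rw [hza, norm_sub_rev z]; linarith
  have h2 : ‖x i - y (σ a)‖ ≤ 7 / 10 * ℓ := by
    calc ‖x i - y (σ a)‖ = ‖(x i - z) + (z - y (σ a))‖ := by congr 1; abel
      _ ≤ ‖x i - z‖ + ‖z - y (σ a)‖ := norm_add_le _ _
      _ ≤ 7 / 10 * ℓ := by rw [hzy]; linarith
  have hp0 : 0 ≤ p := by linarith
  have h3 := rpow_add_rpow_le_of_optimal hσ hai
  have h4 : (7 / 10 : ℝ) ^ p ≤ 49 / 100 := by
    calc (7 / 10 : ℝ) ^ p ≤ (7 / 10 : ℝ) ^ (2 : ℝ) :=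
          Real.rpow_le_rpow_of_exponent_ge (by norm_num) (by norm_num) hp
      _ = 49 / 100 := by norm_num
  have h5 := Real.rpow_le_rpow (norm_nonneg _) h1 hp0
  have h6 := Real.rpow_le_rpow (norm_nonneg _) h2 hp0
  rw [Real.mul_rpow (by norm_num) hℓ0] at h5 h6
  have h7 : 0 < ℓ ^ p := Real.rpow_pos_of_pos hpos p
  have h8 : 0 ≤ ‖x i - y (σ i)‖ ^ p := by positivity
  rw [← hℓ] at h3
  nlinarith

theorem bMatchCost_le_of_perm (hp : 0 ≤ p) {x y : Fin n → EuclideanSpace ℝ (Fin d)} {R : ℝ}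
    (h : ∃ σ : Equiv.Perm (Fin n), ∀ i, ‖x i - y (σ i)‖ ≤ R) : bMatchCost p x y ≤ n * R ^ p := by
  obtain ⟨σ, hσ⟩ := h
  calc bMatchCost p x y ≤ ∑ i, ‖x i - y (σ i)‖ ^ p := bMatchCost_le x y σ
    _ ≤ ∑ _i : Fin n, R ^ p :=
        Finset.sum_le_sum fun i _ => Real.rpow_le_rpow (norm_nonneg _) (hσ i) hp
    _ = n * R ^ p := by simp

/-- No edge of an optimal matching is long: near its midpoint there would be many edges that are
too expensive. -/
theorem norm_sub_le_of_optimal (hd : 1 ≤ d) (hp : 2 ≤ p) {K : ℕ} {L : ℝ}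
    {x y : Fin n → EuclideanSpace ℝ (Fin d)} (hx : IsRegularSample K L x)
    (hy : IsRegularSample K L y) (hL : 2 * L ≤ √(n / 2 ^ (K * d)))
    (hC : bMatchCost p x y ≤ n * (√d * (2 / 2 ^ K)) ^ p)
    {σ : Equiv.Perm (Fin n)} (hσ : bMatchLen p x y σ = bMatchCost p x y) (a : Fin n) :
    ‖x a - y (σ a)‖ ≤ 40 * √d * ((1 / 2 : ℝ) ^ K) ^ (p / (p + d)) := by
  set ℓ := ‖x a - y (σ a)‖ with hℓ
  set w : ℝ := (1 / 2) ^ K with hw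
  have hw0 : 0 < w := by positivity
  have hw1 : w ≤ 1 := pow_le_one₀ (by norm_num) (by norm_num)
  have hd0 : (0 : ℝ) < d := by exact_mod_cast hd
  have hsd : 0 < √(d : ℝ) := Real.sqrt_pos.2 hd0
  have hn : (0 : ℝ) < n := by exact_mod_cast a.pos
  have hp0 : 0 < p := by linarith
  set h := ℓ / (20 * √d) with hh
  have hh0 : 0 ≤ h := by positivity
  suffices hle : h ≤ 2 * w ^ (p / (p + d)) by
    rw [hh, div_le_iff₀ (by positivity)] at hle
    linarith
  have hℓh : ℓ / 10 = 2 * √d * h := by rw [hh]; field_simp; ring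
  have hcube : ∀ z : Fin n → EuclideanSpace ℝ (Fin d), IsRegularSample K L z → ∀ k,
      z k ∈ unitCube d := fun z hz k i => Set.Ico_subset_Icc_self (hz.1 k i)
  have hh1 : h ≤ 1 := by
    have := norm_sub_le_of_mem_unitCube (hcube x hx a) (hcube y hy (σ a))
    rw [hh, div_le_one (by positivity)]
    linarith
  rcases hh0.eq_or_lt with hz | hpos
  · rw [← hz]; positivity
  have hex : ∃ k : ℕ, (1 / 2 : ℝ) ^ k ≤ 2 * h :=
    (exists_pow_lt_of_lt_one (by linarith : 0 < 2 * h) (by norm_num : (1 / 2 : ℝ) < 1)).imp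
      fun _ => le_of_lt
  obtain ⟨k, hk, hk'⟩ : ∃ k : ℕ, (1 / 2 : ℝ) ^ k ≤ 2 * h ∧ h ≤ (1 / 2 : ℝ) ^ k := by
    refine ⟨Nat.find hex, Nat.find_spec hex, ?_⟩
    rcases hf : Nat.find hex with _ | j
    · simpa using hh1
    · have := Nat.find_min hex (show j < Nat.find hex by omega)
      rw [pow_succ]
      linarith
  have hwexp : w ≤ w ^ (p / (p + d)) := by
    conv_lhs => rw [← Real.rpow_one w]
    refine Real.rpow_le_rpow_of_exponent_ge hw0 hw1 ?_
    rw [div_le_one (by positivity)]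
    linarith
  rcases le_or_gt k K with hkK | hkK
  swap
  · have : (1 / 2 : ℝ) ^ k ≤ w := pow_le_pow_of_le_one (by norm_num) (by norm_num) hkK.le
    linarith [Real.rpow_nonneg hw0.le (p / (p + d))]
  set z := midpoint ℝ (x a) (y (σ a)) with hz
  have hzm : ∀ i, z i ∈ Set.Ico (0 : ℝ) 1 := fun i => by
    have e : z i = 1 / 2 * x a i + 1 / 2 * y (σ a) i := by
      rw [hz, midpoint_eq_smul_add]
      simp only [PiLp.smul_apply, PiLp.add_apply, smul_eq_mul, invOf_eq_inv]
      ring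
    have h1 := hx.1 a i
    have h2 := hy.1 (σ a) i
    simp only [Set.mem_Ico] at *
    rw [e]
    constructor <;> linarith
  set m : Fin d → ℕ := fun _ => k with hm
  have hcount : (n : ℝ) / 2 ^ (k * d) / 2 ≤ boxCount m (gridCell m z) x := by
    have h1 := (abs_le.1 (hx.2 m (gridCell m z) (fun _ => hkK) (gridCell_lt hzm))).1
    rw [hm, Finset.sum_const, Finset.card_univ, Fintype.card_fin, smul_eq_mul, mul_comm d k] at h1
    have h2 : 2 * L ≤ √(n / 2 ^ (k * d)) := hL.trans (Real.sqrt_le_sqrt (by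
      gcongr; exact one_le_two))
    have h3 := Real.mul_self_sqrt (show 0 ≤ (n : ℝ) / 2 ^ (k * d) by positivity)
    have h4 := mul_le_mul_of_nonneg_right h2 (Real.sqrt_nonneg ((n : ℝ) / 2 ^ (k * d)))
    rw [hm]
    linarith
  have hcost : (boxCount m (gridCell m z) x : ℝ) * (ℓ / 10) ^ p ≤ bMatchCost p x y := by
    rw [← hσ, bMatchLen, ← nsmul_eq_mul]
    refine (Finset.card_nsmul_le_sum _ (fun i => ‖x i - y (σ i)‖ ^ p) _ fun i hi => ?_).trans
      (Finset.sum_le_sum_of_subset_of_nonneg (Finset.subset_univ _) fun _ _ _ => by positivity)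
    have hi' := (Finset.mem_filter.1 hi).2
    refine Real.rpow_le_rpow (by positivity) ?_ hp0.le
    refine div_ten_le_of_near_midpoint hp hσ a i ?_
    have h1 := norm_sub_le_of_gridCell_near (K := k) (fun l => (hx.1 i l).1)
      (fun l => (hzm l).1) (a := 0) fun l => by
        have := congrFun hi' l
        rw [hm] at this
        omega
    refine h1.trans ?_
    rw [← hℓ, hℓh]
    have : √(d : ℝ) * (((0 : ℕ) + 1) / 2 ^ k) = √d * (1 / 2) ^ k := by
      push_cast; rw [zero_add, one_div_pow]
    rw [this]
    nlinarith
  have hmain : h ^ (p + d) ≤ 2 * w ^ p := by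
    have e1 : √(d : ℝ) * (2 / 2 ^ K) = 2 * √d * w := by rw [hw, one_div_pow]; ring
    have e2 : (n : ℝ) / 2 ^ (k * d) / 2 = n / 2 * ((1 / 2) ^ k) ^ d := by
      rw [← pow_mul, one_div_pow]; ring
    have h1 : (n : ℝ) / 2 * h ^ d * (ℓ / 10) ^ p ≤ n * (√d * (2 / 2 ^ K)) ^ p := by
      refine le_trans ?_ (hcost.trans hC)
      refine le_trans ?_ (mul_le_mul_of_nonneg_right hcount (by positivity))
      rw [e2]
      gcongr
    rw [hℓh, e1, Real.mul_rpow (by positivity) hh0, Real.mul_rpow (by positivity) hw0.le] at h1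
    have h2 : 0 < (2 * √(d : ℝ)) ^ p := Real.rpow_pos_of_pos (by positivity) p
    rw [Real.rpow_add hpos, Real.rpow_natCast]
    refine le_of_mul_le_mul_left ?_ (show 0 < (n : ℝ) / 2 * (2 * √(d : ℝ)) ^ p by positivity)
    linarith
  refine (Real.rpow_le_rpow_iff hh0 (by positivity) (show 0 < p + d by positivity)).1 ?_
  refine hmain.trans ?_
  rw [Real.mul_rpow (by norm_num) (by positivity), ← Real.rpow_mul hw0.le,
    div_mul_cancel₀ _ (by positivity)]
  gcongr
  calc (2 : ℝ) = 2 ^ (1 : ℝ) := (Real.rpow_one 2).symm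
    _ ≤ 2 ^ (p + d) := Real.rpow_le_rpow_of_exponent_le one_le_two (by linarith)

/-- Moments of the edge lengths of optimal matchings of regular samples. -/
theorem exists_sum_norm_rpow_le (hd : 3 ≤ d) (hp1 : 1 ≤ p) (hp2 : p < (d : ℝ) ^ 2 / 2) :
    ∃ s c : ℝ, 0 ≤ s ∧ 2 * p - d < s ∧ 0 < c ∧
      ∀ (n K : ℕ) (L : ℝ) (x y : Fin n → EuclideanSpace ℝ (Fin d)), 0 ≤ L →
        IsRegularSample K L x → IsRegularSample K L y → 2 * L ≤ √(n / 2 ^ (K * d)) →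
        8 * d ^ 2 * K * L ≤ √(n / 2 ^ (K * d)) →
        ∀ σ, bMatchLen p x y σ = bMatchCost p x y →
          ∑ i, ‖x i - y (σ i)‖ ^ (2 * p - 2) ≤ c * (n * ((1 / 2 : ℝ) ^ K) ^ s) := by
  have hd0 : (3 : ℝ) ≤ d := by exact_mod_cast hd
  have hsd : 0 < √(d : ℝ) := Real.sqrt_pos.2 (by linarith)
  have hcost : ∀ (n K : ℕ) (L : ℝ) (x y : Fin n → EuclideanSpace ℝ (Fin d)), 0 ≤ L →
        IsRegularSample K L x → IsRegularSample K L y → 2 * L ≤ √(n / 2 ^ (K * d)) →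
        8 * d ^ 2 * K * L ≤ √(n / 2 ^ (K * d)) →
        bMatchCost p x y ≤ n * (√d * (2 / 2 ^ K)) ^ p := fun n K L x y hL hx hy h1 h2 =>
    bMatchCost_le_of_perm (by linarith) (exists_perm_norm_le (by omega) hL hx hy h1 h2)
  have e1 : ∀ K : ℕ, √(d : ℝ) * (2 / 2 ^ K) = 2 * √d * (1 / 2) ^ K := fun K => by
    rw [one_div_pow]; ring
  rcases lt_or_ge p 2 with hp | hp
  · refine ⟨2 * p - 2, 2 * (2 * √d) ^ (2 * p - 2), by linarith, by linarith, by positivity, ?_⟩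
    intro n K L x y hL hx hy h1 h2 σ hσ
    have hC := hcost n K L x y hL hx hy h1 h2
    rw [e1] at hC
    set w : ℝ := (1 / 2) ^ K with hw
    have hw0 : 0 < w := by positivity
    set R := 2 * √(d : ℝ) * w with hR
    have hR0 : 0 < R := by positivity
    have hterm : ∀ i, ‖x i - y (σ i)‖ ^ (2 * p - 2) ≤
        R ^ (2 * p - 2) + R ^ (p - 2) * ‖x i - y (σ i)‖ ^ p := fun i => by
      rcases le_or_gt ‖x i - y (σ i)‖ R with h | h
      · have := Real.rpow_le_rpow (norm_nonneg _) h (show 0 ≤ 2 * p - 2 by linarith)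
        have : 0 ≤ R ^ (p - 2) * ‖x i - y (σ i)‖ ^ p := by positivity
        linarith
      · have h3 := Real.rpow_le_rpow_of_nonpos hR0 h.le (show p - 2 ≤ 0 by linarith)
        have h4 : ‖x i - y (σ i)‖ ^ (2 * p - 2) =
            ‖x i - y (σ i)‖ ^ (p - 2) * ‖x i - y (σ i)‖ ^ p := by
          rw [← Real.rpow_add (hR0.trans h)]; congr 1; ring
        rw [h4]
        have h5 : ‖x i - y (σ i)‖ ^ (p - 2) * ‖x i - y (σ i)‖ ^ p ≤
          R ^ (p - 2) * ‖x i - y (σ i)‖ ^ p := by gcongr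
        have : 0 ≤ R ^ (2 * p - 2) := by positivity
        linarith
    calc ∑ i, ‖x i - y (σ i)‖ ^ (2 * p - 2)
        ≤ ∑ i, (R ^ (2 * p - 2) + R ^ (p - 2) * ‖x i - y (σ i)‖ ^ p) :=
          Finset.sum_le_sum fun i _ => hterm i
      _ = n * R ^ (2 * p - 2) + R ^ (p - 2) * bMatchCost p x y := by
          rw [Finset.sum_add_distrib, ← Finset.mul_sum, ← hσ]
          simp [bMatchLen]
      _ ≤ n * R ^ (2 * p - 2) + R ^ (p - 2) * (n * R ^ p) := by gcongr
      _ = 2 * (n * R ^ (2 * p - 2)) := by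
          have : R ^ (2 * p - 2) = R ^ (p - 2) * R ^ p := by
            rw [← Real.rpow_add hR0]; congr 1; ring
          rw [this]; ring
      _ = _ := by rw [hR, Real.mul_rpow (by positivity) hw0.le]; ring
  · refine ⟨p + p / (p + d) * (p - 2), (40 * √d) ^ (p - 2) * (2 * √d) ^ p, ?_, ?_,
      by positivity, ?_⟩
    · have : 0 ≤ p / (p + d) * (p - 2) := mul_nonneg (by positivity) (by linarith)
      linarith
    · have : 0 < p + d := by linarith
      rw [div_mul_eq_mul_div, ← sub_lt_iff_lt_add', lt_div_iff₀ this]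
      nlinarith
    intro n K L x y hL hx hy h1 h2 σ hσ
    have hC := hcost n K L x y hL hx hy h1 h2
    have hmax := norm_sub_le_of_optimal (by omega) hp hx hy h1 hC hσ
    rw [e1] at hC
    set w : ℝ := (1 / 2) ^ K with hw
    have hw0 : 0 < w := by positivity
    calc ∑ i, ‖x i - y (σ i)‖ ^ (2 * p - 2)
        ≤ ∑ i, (40 * √d * w ^ (p / (p + d))) ^ (p - 2) * ‖x i - y (σ i)‖ ^ p := by
          refine Finset.sum_le_sum fun i _ => ?_
          have : ‖x i - y (σ i)‖ ^ (2 * p - 2) =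
              ‖x i - y (σ i)‖ ^ (p - 2) * ‖x i - y (σ i)‖ ^ p := by
            rw [← Real.rpow_add_of_nonneg (norm_nonneg _) (by linarith) (by linarith)]
            congr 1; ring
          rw [this]
          exact mul_le_mul_of_nonneg_right
            (Real.rpow_le_rpow (norm_nonneg _) (hmax i) (by linarith)) (by positivity)
      _ = (40 * √d * w ^ (p / (p + d))) ^ (p - 2) * bMatchCost p x y := by
          rw [← Finset.mul_sum, ← hσ]; rfl
      _ ≤ (40 * √d * w ^ (p / (p + d))) ^ (p - 2) * (n * (2 * √d * w) ^ p) := by gcongr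
      _ = _ := by
          rw [Real.mul_rpow (by positivity) (by positivity), Real.mul_rpow (by positivity) hw0.le,
            ← Real.rpow_mul hw0.le, Real.rpow_add hw0]
          ring

end EdgeLengths

section SampleCounts

open ProbabilityTheory

theorem integral_exp_indicator_le {α : Type*} [MeasurableSpace α] (μ : Measure α)
    [IsProbabilityMeasure μ] {Q : Set α} (hQ : MeasurableSet Q) {τ : ℝ} (hτ : |τ| ≤ 1) :
    ∫ u, Real.exp (τ * (Q.indicator 1 u - μ.real Q)) ∂μ ≤ Real.exp (μ.real Q * τ ^ 2) := by
  set q := μ.real Q with hq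
  have hq0 : 0 ≤ q := measureReal_nonneg
  have h : ∀ u, Real.exp (τ * (Q.indicator 1 u - q)) =
      Real.exp (-(τ * q)) * (1 + Q.indicator 1 u * (Real.exp τ - 1)) := fun u => by
    by_cases hu : u ∈ Q
    · simp only [Set.indicator_of_mem hu, Pi.one_apply]
      rw [one_mul, add_sub_cancel, ← Real.exp_add]; congr 1; ring
    · simp [Set.indicator_of_notMem hu]
  have hi : Integrable (fun u => Q.indicator (1 : α → ℝ) u * (Real.exp τ - 1)) μ :=
    ((integrable_const (1 : ℝ)).indicator hQ).mul_const _
  simp_rw [h]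
  rw [integral_const_mul, integral_add (integrable_const _) hi, integral_mul_const,
    integral_indicator_one hQ, ← hq, integral_const, probReal_univ, one_smul]
  calc Real.exp (-(τ * q)) * (1 + q * (Real.exp τ - 1))
      ≤ Real.exp (-(τ * q)) * Real.exp (q * (Real.exp τ - 1)) := by
        gcongr
        rw [add_comm]
        exact Real.add_one_le_exp _
    _ = Real.exp (q * (Real.exp τ - 1 - τ)) := by rw [← Real.exp_add]; congr 1; ring
    _ ≤ _ := by
        gcongr
        exact (le_abs_self _).trans (Real.abs_exp_sub_one_sub_id_le hτ)

theorem measureReal_le_sum_indicator_le {α : Type*} [MeasurableSpace α] (μ : Measure α)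
    [IsProbabilityMeasure μ] {Q : Set α} (hQ : MeasurableSet Q) (n : ℕ)
    (hn : 1 ≤ n * μ.real Q) (L : ℝ) {s : ℝ} (hs : |s| = 1) :
    (Measure.pi fun _ : Fin n => μ).real
        {x | L * √(n * μ.real Q) ≤ s * ∑ k, (Q.indicator 1 (x k) - μ.real Q)} ≤
      Real.exp (1 - L) := by
  set q := μ.real Q with hq
  set r := √(n * q) with hr
  have hr1 : 1 ≤ r := Real.one_le_sqrt.2 hn
  have hr0 : 0 < r := by linarith
  have hrr : r ^ 2 = n * q := Real.sq_sqrt (by linarith)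
  have hτ : |r⁻¹ * s| ≤ 1 := by
    rw [abs_mul, hs, mul_one, abs_of_pos (by positivity)]
    exact inv_le_one_of_one_le₀ hr1
  have hs2 : s ^ 2 = 1 := by rw [← sq_abs, hs, one_pow]
  have hexp : ∀ x : Fin n → α, Real.exp (r⁻¹ * (s * ∑ k, (Q.indicator 1 (x k) - q))) =
      ∏ k, Real.exp (r⁻¹ * s * (Q.indicator 1 (x k) - q)) := fun x => by
    rw [← Real.exp_sum, ← Finset.mul_sum, mul_assoc]
  have hmeas : Measurable fun u => Q.indicator (1 : α → ℝ) u :=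
    measurable_one.indicator hQ
  have h_integrable : Integrable (fun x : Fin n → α =>
      Real.exp (r⁻¹ * (s * ∑ k, (Q.indicator 1 (x k) - q)))) (Measure.pi fun _ => μ) := by
    simp_rw [hexp]
    refine Integrable.fintype_prod (μ := fun _ => μ)
      (f := fun _ u => Real.exp (r⁻¹ * s * (Q.indicator 1 u - q))) fun _ => ?_
    refine integrable_of_abs_le (by fun_prop) (M := Real.exp 1) fun u => ?_
    rw [Real.abs_exp]
    gcongr
    refine (le_abs_self _).trans ?_
    rw [abs_mul]
    refine mul_le_one₀ hτ (abs_nonneg _) ?_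
    have hq0 : 0 ≤ q := measureReal_nonneg
    have hq1 : q ≤ 1 := measureReal_le_one
    by_cases hu : u ∈ Q
    · rw [Set.indicator_of_mem hu, Pi.one_apply, abs_of_nonneg] <;> linarith
    · rw [Set.indicator_of_notMem hu, abs_le]; constructor <;> linarith
  refine (measure_ge_le_exp_mul_mgf (L * r) (by positivity : 0 ≤ r⁻¹) h_integrable).trans ?_
  have hmgf : mgf (fun x : Fin n → α => s * ∑ k, (Q.indicator 1 (x k) - q))
      (Measure.pi fun _ => μ) r⁻¹ ≤ Real.exp 1 := by
    unfold mgf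
    simp_rw [hexp]
    rw [integral_fintype_prod_eq_pow (fun u => Real.exp (r⁻¹ * s * (Q.indicator 1 u - q))),
      Fintype.card_fin]
    refine (pow_le_pow_left₀ (integral_nonneg fun _ => (Real.exp_pos _).le)
      (integral_exp_indicator_le μ hQ hτ) n).trans_eq ?_
    rw [← hq, ← Real.exp_nat_mul, mul_pow, hs2, mul_one, inv_pow, hrr]
    congr 1
    have : (n : ℝ) * q ≠ 0 := by linarith
    rw [← mul_assoc, mul_inv_cancel₀ this]
  calc _ ≤ Real.exp (-r⁻¹ * (L * r)) * Real.exp 1 := by gcongr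
    _ = Real.exp (1 - L) := by
      rw [← Real.exp_add]; congr 1; field_simp; ring

/-- Chernoff bound for the number of sample points in a set. -/
theorem measure_lt_abs_count_sub_le {α : Type*} [MeasurableSpace α] (μ : Measure α)
    [IsProbabilityMeasure μ] {Q : Set α} (hQ : MeasurableSet Q) (n : ℕ)
    (hn : 1 ≤ n * μ.real Q) (L : ℝ) :
    (Measure.pi fun _ : Fin n => μ)
        {x | L * √(n * μ.real Q) <
          |((Finset.univ.filter fun k => x k ∈ Q).card : ℝ) - n * μ.real Q|} ≤
      ENNReal.ofReal (2 * Real.exp (1 - L)) := by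
  have hsum : ∀ x : Fin n → α, ∑ k, (Q.indicator (1 : α → ℝ) (x k) - μ.real Q) =
      ((Finset.univ.filter fun k => x k ∈ Q).card : ℝ) - n * μ.real Q := fun x => by
    rw [Finset.sum_sub_distrib]
    simp [Set.indicator_apply]
  have h1 := measureReal_le_sum_indicator_le μ hQ n hn L (s := 1) (by simp)
  have h2 := measureReal_le_sum_indicator_le μ hQ n hn L (s := -1) (by simp)
  simp_rw [hsum] at h1 h2
  rw [← ofReal_measureReal]
  refine ENNReal.ofReal_le_ofReal ?_
  rw [two_mul]
  refine le_trans ?_ (add_le_add h1 h2)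
  refine (measureReal_mono fun x hx => ?_).trans (measureReal_union_le _ _)
  rw [Set.mem_ofPred_eq] at hx
  rcases lt_abs.1 hx with h | h
  · left; simp only [Set.mem_ofPred_eq]; linarith
  · right; simp only [Set.mem_ofPred_eq]; linarith

variable {d n : ℕ}

theorem measurableSet_gridCell (m b : Fin d → ℕ) :
    MeasurableSet {u : EuclideanSpace ℝ (Fin d) | gridCell m u = b} := by
  have : Measurable (gridCell m) :=
    measurable_pi_lambda _ fun i => Nat.measurable_floor.comp (by fun_prop)
  exact this (measurableSet_singleton b)

theorem cubeUniform_gridCell {m b : Fin d → ℕ} (hb : ∀ i, b i < 2 ^ m i) :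
    (cubeUniform d).real {u | gridCell m u = b} = 1 / 2 ^ ∑ i, m i := by
  rw [measureReal_def, ← (measurePreserving_toLp_cubeUniform d).measure_preimage_equiv]
  have e : (MeasurableEquiv.toLp 2 (Fin d → ℝ)) ⁻¹' {u | gridCell m u = b} =
      Set.univ.pi fun i => {s : ℝ | ⌊2 ^ m i * s⌋₊ = b i} := by
    ext w
    simp [gridCell, funext_iff]
  have h1 : ∀ i, (volume.restrict (Set.Icc (0 : ℝ) 1)) {s : ℝ | ⌊2 ^ m i * s⌋₊ = b i} =
      ENNReal.ofReal (1 / 2 ^ m i) := fun i => by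
    have hpos : (0 : ℝ) < 2 ^ m i := by positivity
    have hms : MeasurableSet {s : ℝ | ⌊2 ^ m i * s⌋₊ = b i} :=
      (Nat.measurable_floor.comp (by fun_prop : Measurable fun s : ℝ => 2 ^ m i * s))
        (measurableSet_singleton (b i))
    have hset : {s : ℝ | ⌊2 ^ m i * s⌋₊ = b i} ∩ Set.Icc 0 1 =
        Set.Ico ((b i : ℝ) / 2 ^ m i) ((b i + 1) / 2 ^ m i) := by
      have hbi : (b i : ℝ) + 1 ≤ 2 ^ m i := by exact_mod_cast hb i
      ext s
      simp only [Set.mem_inter_iff, Set.mem_ofPred_eq, Set.mem_Icc, Set.mem_Ico,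
        div_le_iff₀ hpos, lt_div_iff₀ hpos, mul_comm s]
      constructor
      · rintro ⟨h, h0, -⟩
        exact (Nat.floor_eq_iff (by positivity)).1 h
      · rintro ⟨h, h'⟩
        have hs : 0 ≤ 2 ^ m i * s := (Nat.cast_nonneg _).trans h
        have hs1 : 2 ^ m i * s ≤ 2 ^ m i * 1 := by linarith
        exact ⟨(Nat.floor_eq_iff hs).2 ⟨h, h'⟩, nonneg_of_mul_nonneg_right hs hpos,
          le_of_mul_le_mul_left hs1 hpos⟩
    rw [Measure.restrict_apply hms, hset, Real.volume_Ico]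
    congr 1
    ring
  rw [e, Measure.pi_pi]
  simp_rw [h1]
  rw [← ENNReal.ofReal_prod_of_nonneg fun i _ => by positivity, ENNReal.toReal_ofReal
    (Finset.prod_nonneg fun i _ => by positivity), Finset.prod_div_distrib,
    Finset.prod_pow_eq_pow_sum, Finset.prod_const_one]

theorem ae_pi_mem_Ico (d n : ℕ) : ∀ᵐ x ∂(Measure.pi fun _ : Fin n => cubeUniform d),
    ∀ k i, x k i ∈ Set.Ico (0 : ℝ) 1 := by
  rw [ae_all_iff]
  intro k
  have h : ∀ᵐ v ∂(cubeUniform d), ∀ i, v i ∈ Set.Ico (0 : ℝ) 1 := by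
    rw [← (measurePreserving_toLp_cubeUniform d).map_eq,
      (MeasurableEquiv.toLp 2 (Fin d → ℝ)).measurableEmbedding.ae_map_iff, ae_all_iff]
    intro i
    have h1 : ∀ᵐ s ∂(volume.restrict (Set.Icc (0 : ℝ) 1)), s ∈ Set.Ico (0 : ℝ) 1 := by
      rw [← Measure.restrict_congr_set (Ico_ae_eq_Icc (μ := volume) (a := (0 : ℝ)) (b := 1))]
      exact ae_restrict_mem measurableSet_Ico
    exact (Measure.quasiMeasurePreserving_eval
      (fun _ : Fin d => volume.restrict (Set.Icc (0 : ℝ) 1)) i).ae h1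
  exact (Measure.quasiMeasurePreserving_eval (fun _ : Fin n => cubeUniform d) k).ae h

/-- Samples are regular with high probability. -/
theorem measure_not_isRegularSample_le {K : ℕ} (hK : 2 ^ (K * d) ≤ n) (L : ℝ) :
    (Measure.pi fun _ : Fin n => cubeUniform d) {x | ¬ IsRegularSample K L x} ≤
      ENNReal.ofReal ((((K + 1) * 2 ^ K : ℕ) : ℝ) ^ d * (2 * Real.exp (1 - L))) := by
  set P := Measure.pi fun _ : Fin n => cubeUniform d with hP
  set bad : (Fin d → Fin (K + 1) × Fin (2 ^ K)) → Set (Fin n → EuclideanSpace ℝ (Fin d)) :=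
    fun ι => {x | (∀ i, ((ι i).2 : ℕ) < 2 ^ ((ι i).1 : ℕ)) ∧
      L * √(n / 2 ^ ∑ i, ((ι i).1 : ℕ)) <
        |(boxCount (fun i => ((ι i).1 : ℕ)) (fun i => ((ι i).2 : ℕ)) x : ℝ) -
          n / 2 ^ ∑ i, ((ι i).1 : ℕ)|} with hbad
  have hsub : {x | ¬ IsRegularSample K L x} ⊆
      {x | ¬ ∀ k i, x k i ∈ Set.Ico (0 : ℝ) 1} ∪ ⋃ ι, bad ι := by
    intro x hx
    by_cases h : ∀ k i, x k i ∈ Set.Ico (0 : ℝ) 1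
    swap
    · exact Or.inl h
    right
    have hx' : ¬ IsRegularSample K L x := hx
    rw [IsRegularSample, not_and] at hx'
    have hx2 := hx' h
    push Not at hx2
    obtain ⟨m, b, hm, hb, hlt⟩ := hx2
    refine Set.mem_iUnion.2 ⟨fun i => (⟨m i, Nat.lt_succ_of_le (hm i)⟩,
      ⟨b i, (hb i).trans_le (Nat.pow_le_pow_right two_pos (hm i))⟩), hb, hlt⟩
  have hbadle : ∀ ι, P (bad ι) ≤ ENNReal.ofReal (2 * Real.exp (1 - L)) := by
    intro ι
    by_cases hb : ∀ i, ((ι i).2 : ℕ) < 2 ^ ((ι i).1 : ℕ)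
    swap
    · have : bad ι = ∅ := by
        ext x; simp only [hbad, Set.mem_ofPred_eq, Set.mem_empty_iff_false, iff_false]
        exact fun h => hb h.1
      rw [this, measure_empty]
      exact zero_le
    have hq := cubeUniform_gridCell hb
    have hn : 1 ≤ n * (cubeUniform d).real
        {u | gridCell (fun i => ((ι i).1 : ℕ)) u = fun i => ((ι i).2 : ℕ)} := by
      rw [hq, mul_one_div, one_le_div (by positivity)]
      have : (2 : ℕ) ^ ∑ i, ((ι i).1 : ℕ) ≤ n := by
        refine (Nat.pow_le_pow_right two_pos ?_).trans hK
        calc ∑ i, ((ι i).1 : ℕ) ≤ ∑ _i : Fin d, K :=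
              Finset.sum_le_sum fun i _ => Nat.lt_succ_iff.1 (ι i).1.isLt
          _ = K * d := by simp [mul_comm]
      exact_mod_cast this
    have h := measure_lt_abs_count_sub_le (cubeUniform d) (measurableSet_gridCell _ _) n hn L
    rw [hq, mul_one_div] at h
    refine le_trans (measure_mono fun x hx => ?_) h
    rw [Set.mem_ofPred_eq]
    convert hx.2 using 4
    simp only [boxCount, Set.mem_ofPred_eq]
  calc P {x | ¬ IsRegularSample K L x}
      ≤ P {x | ¬ ∀ k i, x k i ∈ Set.Ico (0 : ℝ) 1} + P (⋃ ι, bad ι) :=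
        (measure_mono hsub).trans (measure_union_le _ _)
    _ = P (⋃ ι, bad ι) := by
        rw [show P {x | ¬ ∀ k i, x k i ∈ Set.Ico (0 : ℝ) 1} = 0 from ae_pi_mem_Ico d n, zero_add]
    _ ≤ ∑ ι, P (bad ι) := measure_iUnion_fintype_le _ _
    _ ≤ ∑ _ι : Fin d → Fin (K + 1) × Fin (2 ^ K), ENNReal.ofReal (2 * Real.exp (1 - L)) :=
        Finset.sum_le_sum fun ι _ => hbadle ι
    _ = _ := by
        rw [Finset.sum_const, Finset.card_univ, ← ENNReal.ofReal_nsmul, nsmul_eq_mul]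
        simp [Fintype.card_prod]

theorem pairMeasure_not_isRegularSample_le {K : ℕ} (hK : 2 ^ (K * d) ≤ n) (L : ℝ) :
    pairMeasure d n {z | ¬ (IsRegularSample K L z.1 ∧ IsRegularSample K L z.2)} ≤
      ENNReal.ofReal (4 * (((K + 1) * 2 ^ K : ℕ) : ℝ) ^ d * Real.exp (1 - L)) := by
  have h := measure_not_isRegularSample_le hK L (d := d) (n := n)
  set S := {x : Fin n → EuclideanSpace ℝ (Fin d) | ¬ IsRegularSample K L x} with hS
  have hsub : {z : (Fin n → EuclideanSpace ℝ (Fin d)) × (Fin n → EuclideanSpace ℝ (Fin d)) |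
      ¬ (IsRegularSample K L z.1 ∧ IsRegularSample K L z.2)} ⊆
      S ×ˢ Set.univ ∪ Set.univ ×ˢ S := by
    intro z hz
    by_cases h1 : IsRegularSample K L z.1
    · exact Or.inr ⟨Set.mem_univ _, fun h2 => hz ⟨h1, h2⟩⟩
    · exact Or.inl ⟨h1, Set.mem_univ _⟩
  calc _ ≤ pairMeasure d n (S ×ˢ Set.univ) + pairMeasure d n (Set.univ ×ˢ S) :=
        (measure_mono hsub).trans (measure_union_le _ _)
    _ ≤ ENNReal.ofReal ((((K + 1) * 2 ^ K : ℕ) : ℝ) ^ d * (2 * Real.exp (1 - L))) +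
        ENNReal.ofReal ((((K + 1) * 2 ^ K : ℕ) : ℝ) ^ d * (2 * Real.exp (1 - L))) := by
        rw [pairMeasure, Measure.prod_prod, Measure.prod_prod, measure_univ, one_mul, mul_one]
        exact add_le_add h h
    _ = _ := by
        rw [← ENNReal.ofReal_add (by positivity) (by positivity)]
        congr 1
        ring

end SampleCounts

section Concentration

open ProbabilityTheory

theorem exists_dyadic_scale {d n : ℕ} (hd : 1 ≤ d) (hn : 1 ≤ n) {ε : ℝ} (hε : 0 < ε)
    (hε1 : 6 * ε ≤ 1) (hA : 16 * d ^ 2 / ε + 2 ≤ (n : ℝ) ^ ε) :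
    ∃ K : ℕ, 2 ^ (K * d) ≤ n ∧ (1 / 2 : ℝ) ^ K ≤ 2 * (n : ℝ) ^ (-((1 - 6 * ε) / d)) ∧
      2 * (n : ℝ) ^ ε ≤ √(n / 2 ^ (K * d)) ∧
      8 * d ^ 2 * K * (n : ℝ) ^ ε ≤ √(n / 2 ^ (K * d)) := by
  have hn1 : (1 : ℝ) ≤ n := by exact_mod_cast hn
  have hn0 : (0 : ℝ) < n := by linarith
  have hd1 : (1 : ℝ) ≤ d := by exact_mod_cast hd
  have hd0 : (0 : ℝ) < d := by linarith
  have hexp : 0 ≤ (1 - 6 * ε) / d := div_nonneg (by linarith) hd0.le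
  obtain ⟨K, hK1, hK2⟩ := exists_nat_pow_near (Real.one_le_rpow hn1 hexp) one_lt_two
  have hKd : (2 : ℝ) ^ (K * d) ≤ (n : ℝ) ^ (1 - 6 * ε) := by
    rw [pow_mul]
    refine (pow_le_pow_left₀ (by positivity) hK1 d).trans_eq ?_
    rw [← Real.rpow_natCast, ← Real.rpow_mul hn0.le, div_mul_cancel₀ _ hd0.ne']
  have hKn : (2 : ℝ) ^ (K * d) ≤ n := hKd.trans <|
    (Real.rpow_le_rpow_of_exponent_le hn1 (by linarith)).trans_eq (Real.rpow_one _)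
  set r := (n : ℝ) ^ ε with hr
  have hr0 : 0 < r := Real.rpow_pos_of_pos hn0 _
  have hr2 : 2 ≤ r := le_trans (by linarith [show 0 ≤ 16 * (d : ℝ) ^ 2 / ε by positivity]) hA
  have hr3 : r ^ 3 ≤ √(n / 2 ^ (K * d)) := by
    refine Real.le_sqrt_of_sq_le ?_
    rw [le_div_iff₀ (by positivity)]
    calc (r ^ 3) ^ 2 * 2 ^ (K * d) ≤ (r ^ 3) ^ 2 * (n : ℝ) ^ (1 - 6 * ε) := by gcongr
      _ = (n : ℝ) := by
        rw [← pow_mul, hr, ← Real.rpow_natCast, ← Real.rpow_mul hn0.le, ← Real.rpow_add hn0]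
        norm_num
        rw [show ε * 6 + (1 - 6 * ε) = 1 by ring, Real.rpow_one]
  have hKlog : (K : ℝ) ≤ 2 * r / ε := by
    have h1 : (K : ℝ) * Real.log 2 ≤ Real.log n := by
      rw [← Real.log_pow]
      refine Real.log_le_log (by positivity) (le_trans ?_ hKn)
      exact pow_le_pow_right₀ one_le_two (Nat.le_mul_of_pos_right K hd)
    have h2 := Real.log_le_rpow_div hn0.le hε
    have h3 := Real.log_two_gt_d9
    have h4 : (K : ℝ) * (1 / 2) ≤ K * Real.log 2 := by gcongr; linarith
    rw [mul_div_assoc]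
    linarith
  refine ⟨K, by exact_mod_cast hKn, ?_, le_trans ?_ hr3, le_trans ?_ hr3⟩
  · rw [one_div, inv_pow, Real.rpow_neg hn0.le, ← div_eq_mul_inv,
      inv_le_comm₀ (by positivity) (by positivity), inv_div, div_le_iff₀ two_pos, ← pow_succ]
    exact hK2.le
  · nlinarith [mul_nonneg hr0.le (show 0 ≤ r ^ 2 - 2 by nlinarith)]
  · calc 8 * (d : ℝ) ^ 2 * K * r ≤ 8 * (d : ℝ) ^ 2 * (2 * r / ε) * r := by gcongr
      _ = 16 * d ^ 2 / ε * r ^ 2 := by ring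
      _ ≤ r * r ^ 2 := by gcongr; linarith
      _ = r ^ 3 := by ring

theorem exists_evariance_bMatchCost_le {d : ℕ} (hd : 3 ≤ d) {p : ℝ} (hp1 : 1 ≤ p)
    (hp2 : p < (d : ℝ) ^ 2 / 2) :
    ∃ θ C : ℝ, 0 < θ ∧ 0 < C ∧ ∀ n : ℕ, 1 ≤ n →
      evariance (fun z => bMatchCost p z.1 z.2) (pairMeasure d n) ≤
        ENNReal.ofReal (C * (n : ℝ) ^ (2 - 2 * p / d - θ)) := by
  obtain ⟨s, c, hs0, hs, hc, hgood⟩ := exists_sum_norm_rpow_le hd hp1 hp2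
  have hd0 : (0 : ℝ) < d := by exact_mod_cast (by omega : 0 < d)
  set η : ℝ := (s - 2 * p + d) / d with hη
  have hη0 : 0 < η := div_pos (by linarith) hd0
  have hsd : 0 ≤ s / d := by positivity
  set δ : ℝ := η / (2 * (s / d + 1 + η)) with hδ
  have hδ0 : 0 < δ := by positivity
  have hδ1 : δ ≤ 1 := by
    rw [hδ, div_le_one (by positivity)]
    linarith
  have hδs : δ * (s / d) ≤ η / 2 := by
    rw [hδ, div_mul_eq_mul_div, div_le_div_iff₀ (by positivity) two_pos]
    nlinarith [mul_nonneg hη0.le hη0.le]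
  set ε := δ / 6 with hε
  have hε0 : 0 < ε := by positivity
  set β := 2 - 2 * p / d - η / 2 with hβ
  obtain ⟨m, hm⟩ := exists_nat_ge ((3 - β) / ε)
  rw [div_le_iff₀ hε0] at hm
  set A := 16 * (d : ℝ) ^ 2 / ε + 2 with hA
  have hA0 : 0 < A := by positivity
  set D := 2 * (d * p ^ 2 * √d ^ (2 * p - 2)) with hD
  have hD0 : 0 < D := by positivity
  set C1 := D * A ^ m with hC1
  set C2 := 2 * (d * p ^ 2 * c * 2 ^ s) with hC2
  set C3 := D * (4 * (Real.exp 1 * m.factorial)) with hC3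
  have hC10 : 0 < C1 := by positivity
  have hC20 : 0 < C2 := by positivity
  have hC30 : 0 < C3 := by positivity
  refine ⟨η / 2, C1 + (C2 + C3), by positivity, by positivity, fun n hn => ?_⟩
  rw [← hβ]
  have hn1 : (1 : ℝ) ≤ n := by exact_mod_cast hn
  have hn0 : (0 : ℝ) < n := by linarith
  have hβ0 : 0 < (n : ℝ) ^ β := Real.rpow_pos_of_pos hn0 _
  have hr0 : 0 < (n : ℝ) ^ ε := Real.rpow_pos_of_pos hn0 _
  have hrm : (n : ℝ) ^ 3 ≤ n ^ β * ((n : ℝ) ^ ε) ^ m := by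
    rw [← Real.rpow_natCast ((n : ℝ) ^ ε), ← Real.rpow_mul hn0.le, ← Real.rpow_add hn0,
      ← Real.rpow_natCast]
    exact Real.rpow_le_rpow_of_exponent_le hn1 (by push_cast; linarith)
  rcases lt_or_ge ((n : ℝ) ^ ε) A with hsmall | hlarge
  · have h := evariance_bMatchCost_le_of_good (d := d) (n := n) hp1 (c := 0) Set.univ
      fun x y _ _ h => (h (Set.mem_univ _)).elim
    refine h.trans ?_
    rw [measure_univ, mul_one, mul_zero, ENNReal.ofReal_zero, zero_add, ← ENNReal.ofReal_ofNat,
      ← ENNReal.ofReal_mul zero_le_two]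
    refine ENNReal.ofReal_le_ofReal ?_
    calc 2 * (d * p ^ 2 * (n * √d ^ (2 * p - 2))) = D * n := by rw [hD]; ring
      _ ≤ D * n ^ 3 := by gcongr; exact le_self_pow₀ hn1 (by norm_num)
      _ ≤ D * (n ^ β * A ^ m) := by gcongr; exact hrm.trans (by gcongr)
      _ = C1 * n ^ β := by rw [hC1]; ring
      _ ≤ _ := by gcongr; linarith
  · obtain ⟨K, hKn, hKs, hL1, hL2⟩ := exists_dyadic_scale (by omega) hn hε0
      (by rw [hε]; linarith) hlarge
    set L := (n : ℝ) ^ ε with hL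
    have h := evariance_bMatchCost_le_of_good (d := d) (n := n) hp1
      {z | ¬ (IsRegularSample K L z.1 ∧ IsRegularSample K L z.2)}
      fun x y _ _ hxy σ hσ => by
        have hxy' := not_not.1 hxy
        exact hgood n K L x y hr0.le hxy'.1 hxy'.2 hL1 hL2 σ hσ
    refine h.trans ?_
    have hgoodle : c * (n * ((1 / 2 : ℝ) ^ K) ^ s) ≤ c * (2 ^ s * n ^ β) := by
      refine mul_le_mul_of_nonneg_left ?_ hc.le
      calc (n : ℝ) * ((1 / 2 : ℝ) ^ K) ^ s
          ≤ n * (2 * (n : ℝ) ^ (-((1 - 6 * ε) / d))) ^ s := by gcongr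
        _ = 2 ^ s * (n : ℝ) ^ (1 + -((1 - 6 * ε) / d) * s) := by
          rw [Real.mul_rpow zero_le_two (by positivity), ← Real.rpow_mul hn0.le,
            Real.rpow_add hn0, Real.rpow_one]
          ring
        _ ≤ _ := by
          refine mul_le_mul_of_nonneg_left (Real.rpow_le_rpow_of_exponent_le hn1 ?_)
            (by positivity)
          have e : 1 + -((1 - 6 * ε) / d) * s = 2 - 2 * p / d - η + δ * (s / d) := by
            rw [hη, hε]; field_simp; ring
          rw [e, hβ]; linarith
    have hbad : 4 * (((K + 1) * 2 ^ K : ℕ) : ℝ) ^ d * Real.exp (1 - L) ≤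
        4 * n ^ 2 * (Real.exp 1 * (m.factorial / L ^ m)) := by
      have h1 : (((K + 1) * 2 ^ K : ℕ) : ℝ) ^ d ≤ n ^ 2 := by
        have : ((K + 1) * 2 ^ K) ^ d ≤ n ^ 2 := by
          calc ((K + 1) * 2 ^ K) ^ d ≤ (2 ^ K * 2 ^ K) ^ d := by
                gcongr; exact Nat.lt_two_pow_self
            _ = (2 ^ (K * d)) ^ 2 := by ring
            _ ≤ n ^ 2 := by gcongr
        exact_mod_cast this
      have h2 : Real.exp (1 - L) ≤ Real.exp 1 * (m.factorial / L ^ m) := by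
        rw [Real.exp_sub, div_eq_mul_inv]
        gcongr
        rw [← inv_div]
        exact inv_anti₀ (by positivity) (Real.pow_div_factorial_le_exp L hr0.le m)
      gcongr
    calc _ ≤ 2 * (ENNReal.ofReal (d * p ^ 2 * (c * (2 ^ s * n ^ β))) +
          ENNReal.ofReal (d * p ^ 2 * (n * √d ^ (2 * p - 2))) *
            ENNReal.ofReal (4 * n ^ 2 * (Real.exp 1 * (m.factorial / L ^ m)))) := by
          gcongr
          exact (pairMeasure_not_isRegularSample_le hKn L).trans (ENNReal.ofReal_le_ofReal hbad)
      _ = ENNReal.ofReal (C2 * n ^ β + C3 * (n ^ 3 / L ^ m)) := by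
          rw [← ENNReal.ofReal_mul (by positivity), ← ENNReal.ofReal_add (by positivity)
            (by positivity), ← ENNReal.ofReal_ofNat, ← ENNReal.ofReal_mul zero_le_two]
          congr 1
          rw [hC2, hC3, hD]
          ring
      _ ≤ _ := by
          refine ENNReal.ofReal_le_ofReal ?_
          have h3 : n ^ 3 / L ^ m ≤ (n : ℝ) ^ β := by
            rw [div_le_iff₀ (by positivity)]; exact hrm
          calc C2 * n ^ β + C3 * (n ^ 3 / L ^ m) ≤ C2 * n ^ β + C3 * n ^ β := by gcongr
            _ ≤ _ := by rw [← add_mul]; exact mul_le_mul_of_nonneg_right (by linarith) hβ0.le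

end Concentration

/-- **Concentration for bipartite matching.**  Let `d ≥ 3` and `1 ≤ p < d²/2`.  There exist
`θ = θ(p,d) > 0` and `C = C(p,d) < ∞` such that for all `n ≥ 1` and `λ > 0`, if
`X_1,…,X_n, Y_1,…,Y_n` are i.i.d. uniform on `[0,1]^d`, then
`ℙ(|C^p_bM(X,Y) − 𝔼[C^p_bM(X,Y)]| ≥ λ n^{1−p/d}) ≤ C n^{−θ} λ^{−2}`. -/
theorem concentration_bipartite_matching
    (d : ℕ) (hd : 3 ≤ d) (p : ℝ) (hp1 : 1 ≤ p) (hp2 : p < (d : ℝ) ^ 2 / 2) :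
    ∃ θ C : ℝ, 0 < θ ∧ 0 < C ∧
      ∀ n : ℕ, 1 ≤ n → ∀ lam : ℝ, 0 < lam →
        pairMeasure d n
            {xy : (Fin n → EuclideanSpace ℝ (Fin d)) × (Fin n → EuclideanSpace ℝ (Fin d)) |
              lam * (n : ℝ) ^ (1 - p / d) ≤
                |bMatchCost p xy.1 xy.2 -
                  ∫ zw, bMatchCost p zw.1 zw.2 ∂(pairMeasure d n)|} ≤
          ENNReal.ofReal (C * (n : ℝ) ^ (-θ) * lam ^ (-2 : ℝ)) := by
  obtain ⟨θ, C, hθ, hC, h⟩ := exists_evariance_bMatchCost_le hd hp1 hp2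
  refine ⟨θ, C, hθ, hC, fun n hn lam hlam => ?_⟩
  have hn0 : (0 : ℝ) < n := by exact_mod_cast hn
  have hc : 0 < lam * (n : ℝ) ^ (1 - p / d) := mul_pos hlam (Real.rpow_pos_of_pos hn0 _)
  have hcheb := ProbabilityTheory.meas_ge_le_evariance_div_sq (μ := pairMeasure d n)
    (continuous_bMatchCost d n hp1).aestronglyMeasurable
    (c := (lam * (n : ℝ) ^ (1 - p / d)).toNNReal) (Real.toNNReal_pos.2 hc).ne'
  rw [Real.coe_toNNReal _ hc.le, ← ENNReal.ofReal, ← ENNReal.ofReal_pow hc.le] at hcheb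
  refine hcheb.trans ?_
  refine (ENNReal.div_le_div_right (h n hn) _).trans_eq ?_
  rw [← ENNReal.ofReal_div_of_pos (by positivity)]
  congr 1
  rw [div_eq_iff (by positivity), mul_pow, ← Real.rpow_natCast ((n : ℝ) ^ (1 - p / d)),
    ← Real.rpow_mul hn0.le, Real.rpow_neg hlam.le, Real.rpow_two,
    show 2 - 2 * p / d - θ = -θ + (1 - p / d) * (2 : ℕ) by push_cast; ring, Real.rpow_add hn0]
  field_simp
end

section
/- For every p > 1 there exist ε = ε(p) ∈ (0, 1/2) and C = C(p) < ∞ such that the following holds for every d ≥ 1. Let x_1,…,x_n, y_1,…,y_n be points in [0,1]^d and let σ be a permutation achieving the minimum in the bipartite matching p-cost. For each i ∈ {1,…,n}, let B_i be the Euclidean ball centered at (x_i + y_{σ(i)})/2 of radius ε·|x_i − y_{σ(i)}|. Then (#{ j ∈ {1,…,n} : x_j ∈ B_i }) · |x_i − y_{σ(i)}|^p ≤ C · ∑_{j : x_j ∈ B_i} |x_j − y_{σ(j)}|^p. -/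
open MeasureTheory Metric
open scoped Classical

/-- Exchanging the partners of two points does not decrease the cost of an optimal matching. -/
theorem bMatchLen_swap_optimal {d n : ℕ} {p : ℝ} {x y : Fin n → EuclideanSpace ℝ (Fin d)}
    {σ : Equiv.Perm (Fin n)} (hσ : ∀ τ, bMatchLen p x y σ ≤ bMatchLen p x y τ)
    {i j : Fin n} (hij : i ≠ j) :
    ‖x i - y (σ i)‖ ^ p + ‖x j - y (σ j)‖ ^ p ≤
      ‖x i - y (σ j)‖ ^ p + ‖x j - y (σ i)‖ ^ p := by
  have h := sub_nonneg.2 (hσ (σ * Equiv.swap i j))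
  unfold bMatchLen at h
  rw [← Finset.sum_sub_distrib, Fintype.sum_eq_add i j hij] at h
  · simp only [Equiv.Perm.mul_apply, Equiv.swap_apply_left, Equiv.swap_apply_right] at h
    linarith
  · rintro k ⟨hki, hkj⟩
    simp [Equiv.swap_apply_of_ne_of_ne hki hkj]

/-- In an optimal matching, an edge starting near the midpoint of another edge is not much
shorter than that edge. -/
theorem mul_edge_le_edge_of_mem_ball {d n : ℕ} {p : ℝ} (hp : 1 < p) {η : ℝ} (hη : 0 < η)
    (hηp : 1 / 2 + 2 * η < (1 / 2 : ℝ) ^ p⁻¹)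
    {x y : Fin n → EuclideanSpace ℝ (Fin d)} {σ : Equiv.Perm (Fin n)}
    (hσ : ∀ τ, bMatchLen p x y σ ≤ bMatchLen p x y τ) {i j : Fin n}
    (hj : x j ∈ ball (midpoint ℝ (x i) (y (σ i))) (η * ‖x i - y (σ i)‖)) :
    η * ‖x i - y (σ i)‖ ≤ ‖x j - y (σ j)‖ := by
  by_contra! hlt
  have hL : 0 < ‖x i - y (σ i)‖ :=
    pos_of_mul_pos_right ((norm_nonneg _).trans_lt hlt) hη.le
  have hlow : (1 / 2 : ℝ) ^ p⁻¹ < 1 :=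
    Real.rpow_lt_one (by norm_num) (by norm_num) (by positivity)
  have hij : i ≠ j := by
    rintro rfl
    nlinarith
  have hswap := bMatchLen_swap_optimal hσ hij
  rw [mem_ball] at hj
  have hmi : dist (x i) (midpoint ℝ (x i) (y (σ i))) = 1 / 2 * ‖x i - y (σ i)‖ := by
    simp [dist_eq_norm, norm_smul]
  have hmy : dist (midpoint ℝ (x i) (y (σ i))) (y (σ i)) = 1 / 2 * ‖x i - y (σ i)‖ := by
    simp [dist_eq_norm, norm_smul]
  have hjy := dist_triangle (x j) (midpoint ℝ (x i) (y (σ i))) (y (σ i))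
  have hix := dist_triangle (x i) (midpoint ℝ (x i) (y (σ i))) (x j)
  have hiy := dist_triangle (x i) (x j) (y (σ j))
  rw [dist_comm (midpoint ℝ (x i) (y (σ i))) (x j)] at hix
  rw [dist_eq_norm (x j) (y (σ i))] at hjy
  rw [dist_eq_norm (x i) (y (σ j)), dist_eq_norm (x j) (y (σ j))] at hiy
  have hbound : ∀ v : EuclideanSpace ℝ (Fin d),
      ‖v‖ ≤ (1 / 2 + 2 * η) * ‖x i - y (σ i)‖ → ‖v‖ ^ p < 1 / 2 * ‖x i - y (σ i)‖ ^ p := by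
    intro v hv
    have hlt' : ‖v‖ < (1 / 2 : ℝ) ^ p⁻¹ * ‖x i - y (σ i)‖ :=
      hv.trans_lt (mul_lt_mul_of_pos_right hηp hL)
    have := Real.rpow_lt_rpow (norm_nonneg v) hlt' (zero_lt_one.trans hp)
    rwa [Real.mul_rpow (by positivity) hL.le,
      Real.rpow_inv_rpow (by norm_num) (by linarith)] at this
  have hij_lt := hbound (x i - y (σ j)) (by linarith)
  have hji_lt := hbound (x j - y (σ i)) (by nlinarith)
  have hnonneg : 0 ≤ ‖x j - y (σ j)‖ ^ p := by positivity
  linarith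

/-- **Local edge-to-energy control for bipartite matching.**  For every `p > 1` there exist
`ε = ε(p) ∈ (0,1/2)` and `C = C(p) < ∞` such that for every `d ≥ 1`, points
`x_1,…,x_n, y_1,…,y_n ∈ [0,1]^d` and any optimizer `σ` of the bipartite matching `p`-cost,
with `B_i = B((x_i + y_{σ(i)})/2, ε|x_i − y_{σ(i)}|)`, one has
`#{j : x_j ∈ B_i} · |x_i − y_{σ(i)}|^p ≤ C ∑_{j : x_j ∈ B_i} |x_j − y_{σ(j)}|^p`. -/
theorem local_edge_to_energy_matching (p : ℝ) (hp : 1 < p) :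
    ∃ ε C : ℝ, ε ∈ Set.Ioo (0 : ℝ) (1 / 2) ∧ 0 < C ∧
      ∀ d : ℕ, 1 ≤ d →
        ∀ (n : ℕ) (x y : Fin n → EuclideanSpace ℝ (Fin d)),
          (∀ i, x i ∈ unitCube d) → (∀ j, y j ∈ unitCube d) →
          ∀ σ : Equiv.Perm (Fin n),
            (∀ τ : Equiv.Perm (Fin n), bMatchLen p x y σ ≤ bMatchLen p x y τ) →
            ∀ i : Fin n,
              ((Finset.univ.filter fun j =>
                  x j ∈ ball (midpoint ℝ (x i) (y (σ i)))
                    (ε * ‖x i - y (σ i)‖)).card : ℝ) * ‖x i - y (σ i)‖ ^ p ≤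
                C * ∑ j ∈ Finset.univ.filter (fun j =>
                    x j ∈ ball (midpoint ℝ (x i) (y (σ i))) (ε * ‖x i - y (σ i)‖)),
                  ‖x j - y (σ j)‖ ^ p := by
  have ha : (1 / 2 : ℝ) < (1 / 2 : ℝ) ^ p⁻¹ :=
    Real.self_lt_rpow_of_lt_one (by norm_num) (by norm_num) (inv_lt_one_of_one_lt₀ hp)
  have ha1 : (1 / 2 : ℝ) ^ p⁻¹ < 1 :=
    Real.rpow_lt_one (by norm_num) (by norm_num) (by positivity)
  obtain ⟨η, hη, hηp⟩ : ∃ η : ℝ, 0 < η ∧ 1 / 2 + 2 * η < (1 / 2 : ℝ) ^ p⁻¹ :=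
    ⟨((1 / 2 : ℝ) ^ p⁻¹ - 1 / 2) / 4, by linarith, by linarith⟩
  refine ⟨η, (η ^ p)⁻¹, ⟨hη, by linarith⟩, by positivity, ?_⟩
  intro d _ n x y _ _ σ hσ i
  rw [← nsmul_eq_mul, Finset.mul_sum]
  refine Finset.card_nsmul_le_sum _ _ _ fun j hj => ?_
  have hle := mul_edge_le_edge_of_mem_ball hp hη hηp hσ (Finset.mem_filter.1 hj).2
  rw [le_inv_mul_iff₀ (by positivity), ← Real.mul_rpow hη.le (norm_nonneg _)]
  exact Real.rpow_le_rpow (by positivity) hle (by linarith)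
end

section
/- For every p > 1 there exist ε = ε(p) ∈ (0, 1/2) and C = C(p) < ∞ such that the following holds for every d ≥ 1. Let x_i, y_{σ(i)}, x_j, y_{σ(j)} be points in ℝ^d satisfying the two-point swap inequality |x_i − y_{σ(i)}|^p + |x_j − y_{σ(j)}|^p ≤ |x_i − y_{σ(j)}|^p + |x_j − y_{σ(i)}|^p, and suppose that |x_j − (x_i + y_{σ(i)})/2| ≤ ε·|x_i − y_{σ(i)}|. Then |x_i − y_{σ(i)}|^p ≤ C · |x_j − y_{σ(j)}|^p. -/
/-- **Pointwise consequence of the two-point swap inequality.**  For every `p > 1` there exist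
`ε = ε(p) ∈ (0,1/2)` and `C = C(p) < ∞` such that for every `d ≥ 1`: if points
`x_i, y_{σ(i)}, x_j, y_{σ(j)} ∈ ℝ^d` satisfy the two-point swap inequality
`|x_i − y_{σ(i)}|^p + |x_j − y_{σ(j)}|^p ≤ |x_i − y_{σ(j)}|^p + |x_j − y_{σ(i)}|^p` and
`|x_j − (x_i + y_{σ(i)})/2| ≤ ε |x_i − y_{σ(i)}|`, then
`|x_i − y_{σ(i)}|^p ≤ C |x_j − y_{σ(j)}|^p`. -/
theorem swap_inequality_pointwise (p : ℝ) (hp : 1 < p) :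
    ∃ ε C : ℝ, ε ∈ Set.Ioo (0 : ℝ) (1 / 2) ∧ 0 < C ∧
      ∀ d : ℕ, 1 ≤ d →
        ∀ xi yi xj yj : EuclideanSpace ℝ (Fin d),
          ‖xi - yi‖ ^ p + ‖xj - yj‖ ^ p ≤ ‖xi - yj‖ ^ p + ‖xj - yi‖ ^ p →
          ‖xj - midpoint ℝ xi yi‖ ≤ ε * ‖xi - yi‖ →
          ‖xi - yi‖ ^ p ≤ C * ‖xj - yj‖ ^ p := by
  have hp0 : 0 < p := by linarith
  obtain ⟨q, hq, hq1, hqp⟩ : ∃ q : ℝ, 1 / 2 < q ∧ q < 1 ∧ q ^ p = 1 / 2 := by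
    refine ⟨(1 / 2 : ℝ) ^ (1 / p), ?_, ?_, ?_⟩
    · have h : 1 / p < 1 := by rw [div_lt_one hp0]; exact hp
      simpa using Real.rpow_lt_rpow_of_exponent_gt (x := (1 / 2 : ℝ)) (by norm_num)
        (by norm_num) h
    · exact Real.rpow_lt_one (by norm_num) (by norm_num) (by positivity)
    · rw [← Real.rpow_mul (by norm_num), one_div_mul_cancel hp0.ne', Real.rpow_one]
  obtain ⟨ε, hε⟩ : ∃ ε : ℝ, 3 * ε = q - 1 / 2 := ⟨(q - 1 / 2) / 3, by ring⟩
  have hε0 : 0 < ε := by linarith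
  refine ⟨ε, (1 / ε) ^ p, ⟨hε0, by linarith⟩, by positivity, ?_⟩
  intro d _ xi yi xj yj hswap hmid
  have hxi : ‖xi - midpoint ℝ xi yi‖ = 1 / 2 * ‖xi - yi‖ := by
    rw [← dist_eq_norm, ← dist_eq_norm, dist_left_midpoint]; norm_num
  have hyi : ‖midpoint ℝ xi yi - yi‖ = 1 / 2 * ‖xi - yi‖ := by
    rw [← dist_eq_norm, ← dist_eq_norm, dist_midpoint_right]; norm_num
  have hb : ‖xj - yi‖ ≤ (1 / 2 + ε) * ‖xi - yi‖ := by
    have := norm_sub_le_norm_sub_add_norm_sub xj (midpoint ℝ xi yi) yi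
    linarith
  have ha : ‖xi - yj‖ ≤ (1 / 2 + ε) * ‖xi - yi‖ + ‖xj - yj‖ := by
    have h1 := norm_sub_le_norm_sub_add_norm_sub xi (midpoint ℝ xi yi) yj
    have h2 := norm_sub_le_norm_sub_add_norm_sub (midpoint ℝ xi yi) xj yj
    rw [norm_sub_rev _ xj] at h2
    linarith
  have key : ε * ‖xi - yi‖ ≤ ‖xj - yj‖ := by
    by_contra! h
    have hL : 0 < ‖xi - yi‖ := pos_of_mul_pos_right ((norm_nonneg _).trans_lt h) hε0.le
    have hεL : 0 < ε * ‖xi - yi‖ := by positivity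
    have hqL : q * ‖xi - yi‖ = (1 / 2 + 3 * ε) * ‖xi - yi‖ := by rw [hε]; ring
    have hq_pow : (q * ‖xi - yi‖) ^ p = 1 / 2 * ‖xi - yi‖ ^ p := by
      rw [Real.mul_rpow (by linarith) hL.le, hqp]
    have h1 : ‖xi - yj‖ ^ p < (q * ‖xi - yi‖) ^ p :=
      Real.rpow_lt_rpow (norm_nonneg _) (by linarith) hp0
    have h2 : ‖xj - yi‖ ^ p < (q * ‖xi - yi‖) ^ p :=
      Real.rpow_lt_rpow (norm_nonneg _) (by linarith) hp0
    have h3 : 0 ≤ ‖xj - yj‖ ^ p := by positivity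
    linarith
  rw [← Real.mul_rpow (by positivity) (norm_nonneg _)]
  refine Real.rpow_le_rpow (norm_nonneg _) ?_ hp0.le
  rw [one_div_mul_eq_div, le_div_iff₀' hε0]
  exact key
end
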